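/- arXiv:1607.07516 — 3 statements merged into one kernel-verified Lean document; each statement's English description precedes it below -/
import Mathlib

section
/- For every n ∈ ℕ, every ε ≥ 0, every δ₁ > 0 and every δ₂ > 0 satisfying ε + δ₁ + δ₂ < 1/2, every shared-randomness SMP protocol Π computing the equality function EQ_n with worst-case error at most ε satisfies IL(Π) ≥ δ₁·(2·√(g₃(ε+δ₁+δ₂))·√n − g₃(ε+δ₁+δ₂) − g₂(n,n,δ₂) − 10) − 2·g₁(2n), where g₁(x) = 2·log₂(x+1) + 10, g₂(x,y,z) = 2·log₂(2(x+y)/(z²·log₂ e) + 1) + 2 and g₃(x) = 2·(1/2 − x)²·log₂ e. -/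
open scoped BigOperators
open scoped Classical

noncomputable section

/-- A probability distribution on a finite type. -/
structure FinDist (Ω : Type) [Fintype Ω] where
  prob : Ω → ℝ
  nonneg : ∀ ω, 0 ≤ prob ω
  sum_one : ∑ ω, prob ω = 1

namespace FinDist

variable {Ω Ω' : Type} [Fintype Ω] [Fintype Ω']

/-- Product of two distributions (independent draw). -/
def prod (p : FinDist Ω) (q : FinDist Ω') : FinDist (Ω × Ω') where
  prob := fun ω => p.prob ω.1 * q.prob ω.2
  nonneg := fun ω => mul_nonneg (p.nonneg _) (q.nonneg _)
  sum_one := by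
    rw [Fintype.sum_prod_type]
    have h : ∀ a : Ω, ∑ b : Ω', p.prob a * q.prob b = p.prob a := by
      intro a; rw [← Finset.mul_sum, q.sum_one, mul_one]
    simp_rw [h]
    exact p.sum_one

/-- Probability of an event. -/
def probEvent (p : FinDist Ω) (E : Ω → Prop) : ℝ :=
  ∑ ω, if E ω then p.prob ω else 0

/-- Probability that a random variable takes a given value. -/
def probVal {α : Type*} (p : FinDist Ω) (A : Ω → α) (a : α) : ℝ :=
  probEvent p (fun ω => A ω = a)

/-- Shannon entropy (in bits) of a random variable on a finite probability space. -/
def entropy {α : Type*} (p : FinDist Ω) (A : Ω → α) : ℝ :=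
  ∑ a ∈ Finset.univ.image A, -(probVal p A a * Real.logb 2 (probVal p A a))

/-- Mutual information (in bits) I(A;B). -/
def mutualInfo {α β : Type*} (p : FinDist Ω) (A : Ω → α) (B : Ω → β) : ℝ :=
  entropy p A + entropy p B - entropy p (fun ω => (A ω, B ω))

/-- Conditional mutual information (in bits) I(A;B|C). -/
def condMutualInfo {α β γ : Type*} (p : FinDist Ω) (A : Ω → α) (B : Ω → β) (C : Ω → γ) : ℝ :=
  entropy p (fun ω => (A ω, C ω)) + entropy p (fun ω => (B ω, C ω))
    - entropy p (fun ω => (A ω, B ω, C ω)) - entropy p C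

/-- Independence of two random variables. -/
def Indep {α β : Type*} (p : FinDist Ω) (A : Ω → α) (B : Ω → β) : Prop :=
  ∀ a b, probEvent p (fun ω => A ω = a ∧ B ω = b) = probVal p A a * probVal p B b

end FinDist

/-- log₂(e). -/
def log2e : ℝ := Real.logb 2 (Real.exp 1)

def g1 (x : ℝ) : ℝ := 2 * Real.logb 2 (x + 1) + 10

def g2 (x y z : ℝ) : ℝ := 2 * Real.logb 2 (2 * (x + y) / (z ^ 2 * log2e) + 1) + 2

def g3 (x : ℝ) : ℝ := 2 * (1 / 2 - x) ^ 2 * log2e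

/-- A private-coin SMP protocol for computing functions f : X × Y → Z. -/
structure PrivSMP (X Y Z : Type) [Fintype X] [Fintype Y] [Fintype Z] where
  MA : Type
  MB : Type
  RA : Type
  RB : Type
  RC : Type
  [fMA : Fintype MA]
  [fMB : Fintype MB]
  [fRA : Fintype RA]
  [fRB : Fintype RB]
  [fRC : Fintype RC]
  [neMA : Nonempty MA]
  [neMB : Nonempty MB]
  [neRA : Nonempty RA]
  [neRB : Nonempty RB]
  [neRC : Nonempty RC]
  dRA : FinDist RA
  dRB : FinDist RB
  dRC : FinDist RC
  pA : X → RA → MA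
  pB : Y → RB → MB
  pC : MA → MB → RC → Z

attribute [instance] PrivSMP.fMA PrivSMP.fMB PrivSMP.fRA PrivSMP.fRB PrivSMP.fRC
attribute [instance] PrivSMP.neMA PrivSMP.neMB PrivSMP.neRA PrivSMP.neRB PrivSMP.neRC

namespace PrivSMP

variable {X Y Z : Type} [Fintype X] [Fintype Y] [Fintype Z]

/-- Joint distribution of all the (independent) randomness of the protocol,
ordered as (r_A, r_B, r_C). -/
def randDist (P : PrivSMP X Y Z) : FinDist (P.RA × P.RB × P.RC) :=
  P.dRA.prod (P.dRB.prod P.dRC)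

/-- Probability of error on input (x, y). -/
def err (P : PrivSMP X Y Z) (f : X → Y → Z) (x : X) (y : Y) : ℝ :=
  FinDist.probEvent P.randDist (fun r => P.pC (P.pA x r.1) (P.pB y r.2.1) r.2.2 ≠ f x y)

/-- The protocol computes f with worst-case error at most ε. -/
def Computes (P : PrivSMP X Y Z) (f : X → Y → Z) (ε : ℝ) : Prop :=
  ∀ x y, P.err f x y ≤ ε

/-- Communication cost ⌈log₂|M_A|⌉ + ⌈log₂|M_B|⌉. -/
def CC (P : PrivSMP X Y Z) : ℝ :=
  (⌈Real.logb 2 (Fintype.card P.MA)⌉ : ℝ) + (⌈Real.logb 2 (Fintype.card P.MB)⌉ : ℝ)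

end PrivSMP

/-- Private-coin communication complexity of f with error ε. -/
def CCprivf {X Y Z : Type} [Fintype X] [Fintype Y] [Fintype Z]
    (f : X → Y → Z) (ε : ℝ) : ℝ :=
  sInf {c : ℝ | ∃ P : PrivSMP X Y Z, P.Computes f ε ∧ P.CC = c}

/-- A shared-randomness SMP protocol for computing functions f : X × Y → Z. -/
structure ShSMP (X Y Z : Type) [Fintype X] [Fintype Y] [Fintype Z] where
  MA : Type
  MB : Type
  RA : Type
  RB : Type
  RC : Type
  RAC : Type
  RBC : Type
  [fMA : Fintype MA]
  [fMB : Fintype MB]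
  [fRA : Fintype RA]
  [fRB : Fintype RB]
  [fRC : Fintype RC]
  [fRAC : Fintype RAC]
  [fRBC : Fintype RBC]
  [neMA : Nonempty MA]
  [neMB : Nonempty MB]
  [neRA : Nonempty RA]
  [neRB : Nonempty RB]
  [neRC : Nonempty RC]
  [neRAC : Nonempty RAC]
  [neRBC : Nonempty RBC]
  dRA : FinDist RA
  dRB : FinDist RB
  dRC : FinDist RC
  dRAC : FinDist RAC
  dRBC : FinDist RBC
  pA : X → RA → RAC → MA
  pB : Y → RB → RBC → MB
  pC : MA → MB → RC → RAC → RBC → Z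

attribute [instance] ShSMP.fMA ShSMP.fMB ShSMP.fRA ShSMP.fRB ShSMP.fRC ShSMP.fRAC ShSMP.fRBC
attribute [instance] ShSMP.neMA ShSMP.neMB ShSMP.neRA ShSMP.neRB ShSMP.neRC ShSMP.neRAC
  ShSMP.neRBC

namespace ShSMP

variable {X Y Z : Type} [Fintype X] [Fintype Y] [Fintype Z]

/-- Joint distribution of all the (independent) randomness of the protocol,
ordered as (r_A, r_B, r_C, r_AC, r_BC). -/
def randDist (P : ShSMP X Y Z) : FinDist (P.RA × P.RB × P.RC × P.RAC × P.RBC) :=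
  P.dRA.prod (P.dRB.prod (P.dRC.prod (P.dRAC.prod P.dRBC)))

/-- Probability of error on input (x, y). -/
def err (P : ShSMP X Y Z) (f : X → Y → Z) (x : X) (y : Y) : ℝ :=
  FinDist.probEvent P.randDist
    (fun r => P.pC (P.pA x r.1 r.2.2.2.1) (P.pB y r.2.1 r.2.2.2.2) r.2.2.1 r.2.2.2.1 r.2.2.2.2
      ≠ f x y)

/-- The protocol computes f with worst-case error at most ε. -/
def Computes (P : ShSMP X Y Z) (f : X → Y → Z) (ε : ℝ) : Prop :=
  ∀ x y, P.err f x y ≤ ε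

/-- Communication cost ⌈log₂|M_A|⌉ + ⌈log₂|M_B|⌉. -/
def CC (P : ShSMP X Y Z) : ℝ :=
  (⌈Real.logb 2 (Fintype.card P.MA)⌉ : ℝ) + (⌈Real.logb 2 (Fintype.card P.MB)⌉ : ℝ)

/-- The underlying probability space when the input pair is drawn from μ, independently
of all the randomness of the protocol. A sample point is
((x, y), (r_A, r_B, r_C, r_AC, r_BC)). -/
def space (P : ShSMP X Y Z) (μ : FinDist (X × Y)) :
    FinDist ((X × Y) × (P.RA × P.RB × P.RC × P.RAC × P.RBC)) :=
  μ.prod P.randDist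

/-- Alice's message as a random variable. -/
def rvMA (P : ShSMP X Y Z) (ω : (X × Y) × (P.RA × P.RB × P.RC × P.RAC × P.RBC)) : P.MA :=
  P.pA ω.1.1 ω.2.1 ω.2.2.2.2.1

/-- Bob's message as a random variable. -/
def rvMB (P : ShSMP X Y Z) (ω : (X × Y) × (P.RA × P.RB × P.RC × P.RAC × P.RBC)) : P.MB :=
  P.pB ω.1.2 ω.2.2.1 ω.2.2.2.2.2

/-- The referee's private randomness as a random variable. -/
def rvRC (P : ShSMP X Y Z) (ω : (X × Y) × (P.RA × P.RB × P.RC × P.RAC × P.RBC)) : P.RC :=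
  ω.2.2.2.1

/-- The Alice–referee shared randomness as a random variable. -/
def rvRAC (P : ShSMP X Y Z) (ω : (X × Y) × (P.RA × P.RB × P.RC × P.RAC × P.RBC)) : P.RAC :=
  ω.2.2.2.2.1

/-- The Bob–referee shared randomness as a random variable. -/
def rvRBC (P : ShSMP X Y Z) (ω : (X × Y) × (P.RA × P.RB × P.RC × P.RAC × P.RBC)) : P.RBC :=
  ω.2.2.2.2.2

/-- Information leakage of the protocol on input distribution μ :
IL(Π,μ) = I(XY ; M_A M_B R_C R_AC R_BC). -/
def IL (P : ShSMP X Y Z) (μ : FinDist (X × Y)) : ℝ :=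
  FinDist.mutualInfo (P.space μ) (fun ω => ω.1)
    (fun ω => (P.rvMA ω, P.rvMB ω, P.rvRC ω, P.rvRAC ω, P.rvRBC ω))

/-- Worst-case (over input distributions) information leakage IL(Π). -/
def ILmax (P : ShSMP X Y Z) : ℝ :=
  ⨆ μ : FinDist (X × Y), P.IL μ

/-- Information complexity of the protocol on input distribution μ :
IC(Π,μ) = I(X ; M_A | R_AC) + I(Y ; M_B | R_BC). -/
def IC (P : ShSMP X Y Z) (μ : FinDist (X × Y)) : ℝ :=
  FinDist.condMutualInfo (P.space μ) (fun ω => ω.1.1) (fun ω => P.rvMA ω) (fun ω => P.rvRAC ω)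
    + FinDist.condMutualInfo (P.space μ) (fun ω => ω.1.2) (fun ω => P.rvMB ω)
      (fun ω => P.rvRBC ω)

/-- Worst-case (over input distributions) information complexity IC(Π). -/
def ICmax (P : ShSMP X Y Z) : ℝ :=
  ⨆ μ : FinDist (X × Y), P.IC μ

end ShSMP

/-- Shared-randomness communication complexity of f with error ε. -/
def CCshf {X Y Z : Type} [Fintype X] [Fintype Y] [Fintype Z]
    (f : X → Y → Z) (ε : ℝ) : ℝ :=
  sInf {c : ℝ | ∃ P : ShSMP X Y Z, P.Computes f ε ∧ P.CC = c}

/-- Information leakage for computing f with error ε. -/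
def ILf {X Y Z : Type} [Fintype X] [Fintype Y] [Fintype Z]
    (f : X → Y → Z) (ε : ℝ) : ℝ :=
  sInf {c : ℝ | ∃ P : ShSMP X Y Z, P.Computes f ε ∧ P.ILmax = c}

/-- Information complexity for computing f with error ε. -/
def ICf {X Y Z : Type} [Fintype X] [Fintype Y] [Fintype Z]
    (f : X → Y → Z) (ε : ℝ) : ℝ :=
  sInf {c : ℝ | ∃ P : ShSMP X Y Z, P.Computes f ε ∧ P.ICmax = c}

/-- An average-length SMP protocol: a shared-randomness SMP protocol whose (countable)
message sets carry length functions satisfying Kraft's inequality. -/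
structure AvgSMP (X Y Z : Type) [Fintype X] [Fintype Y] [Fintype Z] where
  MA : Type
  MB : Type
  RA : Type
  RB : Type
  RC : Type
  RAC : Type
  RBC : Type
  [cMA : Countable MA]
  [cMB : Countable MB]
  [neMA : Nonempty MA]
  [neMB : Nonempty MB]
  [fRA : Fintype RA]
  [fRB : Fintype RB]
  [fRC : Fintype RC]
  [fRAC : Fintype RAC]
  [fRBC : Fintype RBC]
  [neRA : Nonempty RA]
  [neRB : Nonempty RB]
  [neRC : Nonempty RC]
  [neRAC : Nonempty RAC]
  [neRBC : Nonempty RBC]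
  lA : MA → ℕ
  lB : MB → ℕ
  kraftA : ∑' m : MA, ((2 : ℝ) ^ lA m)⁻¹ ≤ 1
  kraftB : ∑' m : MB, ((2 : ℝ) ^ lB m)⁻¹ ≤ 1
  dRA : FinDist RA
  dRB : FinDist RB
  dRC : FinDist RC
  dRAC : FinDist RAC
  dRBC : FinDist RBC
  pA : X → RA → RAC → MA
  pB : Y → RB → RBC → MB
  pC : MA → MB → RC → RAC → RBC → Z

attribute [instance] AvgSMP.cMA AvgSMP.cMB AvgSMP.neMA AvgSMP.neMB
attribute [instance] AvgSMP.fRA AvgSMP.fRB AvgSMP.fRC AvgSMP.fRAC AvgSMP.fRBC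
attribute [instance] AvgSMP.neRA AvgSMP.neRB AvgSMP.neRC AvgSMP.neRAC AvgSMP.neRBC

namespace AvgSMP

variable {X Y Z : Type} [Fintype X] [Fintype Y] [Fintype Z]

/-- Joint distribution of all the (independent) randomness of the protocol,
ordered as (r_A, r_B, r_C, r_AC, r_BC). -/
def randDist (P : AvgSMP X Y Z) : FinDist (P.RA × P.RB × P.RC × P.RAC × P.RBC) :=
  P.dRA.prod (P.dRB.prod (P.dRC.prod (P.dRAC.prod P.dRBC)))

/-- Probability of error on input (x, y). -/
def err (P : AvgSMP X Y Z) (f : X → Y → Z) (x : X) (y : Y) : ℝ :=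
  FinDist.probEvent P.randDist
    (fun r => P.pC (P.pA x r.1 r.2.2.2.1) (P.pB y r.2.1 r.2.2.2.2) r.2.2.1 r.2.2.2.1 r.2.2.2.2
      ≠ f x y)

/-- The protocol computes f with worst-case error at most ε. -/
def Computes (P : AvgSMP X Y Z) (f : X → Y → Z) (ε : ℝ) : Prop :=
  ∀ x y, P.err f x y ≤ ε

/-- Average communication cost on input (x, y): E[ℓ_A(M_A) + ℓ_B(M_B)]. -/
def CCavOn (P : AvgSMP X Y Z) (x : X) (y : Y) : ℝ :=
  ∑ r : P.RA × P.RB × P.RC × P.RAC × P.RBC, P.randDist.prob r *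
    ((P.lA (P.pA x r.1 r.2.2.2.1) : ℝ) + (P.lB (P.pB y r.2.1 r.2.2.2.2) : ℝ))

/-- Average communication cost of the protocol (worst case over inputs). -/
def CCav (P : AvgSMP X Y Z) : ℝ :=
  ⨆ xy : X × Y, P.CCavOn xy.1 xy.2

/-- The underlying probability space when the input pair is drawn from μ. -/
def space (P : AvgSMP X Y Z) (μ : FinDist (X × Y)) :
    FinDist ((X × Y) × (P.RA × P.RB × P.RC × P.RAC × P.RBC)) :=
  μ.prod P.randDist

/-- Information complexity of the protocol on input distribution μ :
IC(Π,μ) = I(X ; M_A | R_AC) + I(Y ; M_B | R_BC). -/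
def IC (P : AvgSMP X Y Z) (μ : FinDist (X × Y)) : ℝ :=
  FinDist.condMutualInfo (P.space μ) (fun ω => ω.1.1)
      (fun ω => P.pA ω.1.1 ω.2.1 ω.2.2.2.2.1) (fun ω => ω.2.2.2.2.1)
    + FinDist.condMutualInfo (P.space μ) (fun ω => ω.1.2)
      (fun ω => P.pB ω.1.2 ω.2.2.1 ω.2.2.2.2.2) (fun ω => ω.2.2.2.2.2)

/-- Worst-case (over input distributions) information complexity. -/
def ICmax (P : AvgSMP X Y Z) : ℝ :=
  ⨆ μ : FinDist (X × Y), P.IC μ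

end AvgSMP

/-- Average-length communication complexity of f with error ε. -/
def CCavf {X Y Z : Type} [Fintype X] [Fintype Y] [Fintype Z]
    (f : X → Y → Z) (ε : ℝ) : ℝ :=
  sInf {c : ℝ | ∃ P : AvgSMP X Y Z, P.Computes f ε ∧ P.CCav = c}

/-- The equality function on n-bit strings. -/
def EQfun (n : ℕ) : (Fin n → Bool) → (Fin n → Bool) → Bool :=
  fun x y => decide (x = y)

end



namespace EqIL

/-- Donsker–Varadhan type inequality in tilted form. -/
lemma dv {α : Type*} [Fintype α] (p q L φ : α → ℝ) (hp : ∀ a, 0 ≤ p a) (hp1 : ∑ a, p a = 1)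
    (hL : ∀ a, p a * Real.exp (-L a) ≤ q a) :
    ∑ a, p a * (φ a - L a) ≤ Real.log (∑ a, q a * Real.exp (φ a)) := by
  set K := ∑ a, p a * Real.exp (φ a - L a) with hK
  have hKpos : 0 < K := by
    have hne : ∃ a, 0 < p a := by
      by_contra h
      push Not at h
      have : ∑ a, p a ≤ 0 := Finset.sum_nonpos (fun a _ => h a)
      linarith
    obtain ⟨a, ha⟩ := hne
    exact Finset.sum_pos' (fun b _ => mul_nonneg (hp b) (Real.exp_pos _).le)
      ⟨a, Finset.mem_univ _, mul_pos ha (Real.exp_pos _)⟩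
  have hKle : K ≤ ∑ a, q a * Real.exp (φ a) := by
    apply Finset.sum_le_sum
    intro a _
    have : p a * Real.exp (φ a - L a) = p a * Real.exp (-L a) * Real.exp (φ a) := by
      rw [mul_assoc, ← Real.exp_add]; congr 2; ring
    rw [this]
    exact mul_le_mul_of_nonneg_right (hL a) (Real.exp_pos _).le
  refine le_trans ?_ (Real.log_le_log hKpos hKle)
  have h1 : ∑ a, p a * (φ a - L a - Real.log K) ≤ ∑ a, (p a * Real.exp (φ a - L a) / K - p a) := by
    apply Finset.sum_le_sum
    intro a _
    have h2 := Real.add_one_le_exp (φ a - L a - Real.log K)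
    rw [Real.exp_sub _ (Real.log K), Real.exp_log hKpos] at h2
    have h3 := mul_le_mul_of_nonneg_left h2 (hp a)
    rw [mul_add, mul_one, ← mul_div_assoc] at h3
    linarith
  rw [Finset.sum_sub_distrib, ← Finset.sum_div, ← hK, div_self hKpos.ne', hp1] at h1
  have h4 : ∑ a, p a * (φ a - L a - Real.log K) = ∑ a, p a * (φ a - L a) - Real.log K := by
    simp_rw [mul_sub _ _ (Real.log K)]
    rw [Finset.sum_sub_distrib, ← Finset.sum_mul, hp1, one_mul]
  linarith

lemma tilt_le {p q : ℝ} (hp : 0 ≤ p) (hq : 0 ≤ q) (hac : q = 0 → p = 0) :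
    p * Real.exp (-(Real.log p - Real.log q)) ≤ q := by
  rcases hp.eq_or_lt with h | h
  · rw [← h, zero_mul]; exact hq
  · have hq' : 0 < q := lt_of_le_of_ne hq (fun h0 => h.ne' (hac h0.symm))
    rw [neg_sub, Real.exp_sub, Real.exp_log h, Real.exp_log hq']
    exact (mul_div_cancel₀ q h.ne').le

lemma sum_pi_prod {α : Type*} [Fintype α] (t : ℕ) (g : Fin t → α → ℝ) :
    ∑ m : Fin t → α, ∏ i, g i (m i) = ∏ i, ∑ a, g i a := by
  rw [Finset.prod_univ_sum, Fintype.piFinset_univ]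

lemma sum_pi_marg {α : Type*} [Fintype α] (t : ℕ) (p f : α → ℝ) (hp1 : ∑ a, p a = 1) :
    ∑ m : Fin t → α, (∏ i, p (m i)) * ∑ j, f (m j) = t * ∑ a, p a * f a := by
  simp_rw [Finset.mul_sum]
  rw [Finset.sum_comm]
  have : ∀ j : Fin t, ∑ m : Fin t → α, (∏ i, p (m i)) * f (m j) = ∑ a, p a * f a := by
    intro j
    have h := sum_pi_prod t (fun i a => if i = j then p a * f a else p a)
    have h2 : ∀ m : Fin t → α, (∏ i, if i = j then p (m i) * f (m i) else p (m i))
        = (∏ i, p (m i)) * f (m j) := by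
      intro m
      have : ∀ i, (if i = j then p (m i) * f (m i) else p (m i))
          = p (m i) * (if i = j then f (m i) else 1) := by
        intro i; split_ifs <;> simp
      simp_rw [this]
      rw [Finset.prod_mul_distrib, Finset.prod_ite_eq' Finset.univ j (fun i => f (m i))]
      simp
    simp_rw [h2] at h
    rw [h, Finset.prod_eq_single j]
    · simp
    · intro i _ hij; simp [hij, hp1]
    · simp
  simp_rw [this]
  simp [Finset.mul_sum]

lemma mgf_one {α : Type*} [Fintype α] (p W : α → ℝ) (hp : ∀ a, 0 ≤ p a) (hp1 : ∑ a, p a = 1)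
    (hW0 : ∀ a, 0 ≤ W a) (hW1 : ∀ a, W a ≤ 1) (u : ℝ) (hu : |u| ≤ 1) :
    ∑ a, p a * Real.exp (u * (W a - ∑ c, p c * W c)) ≤ Real.exp (u ^ 2 / 4) := by
  set e := ∑ c, p c * W c with he
  have he0 : 0 ≤ e := Finset.sum_nonneg (fun a _ => mul_nonneg (hp a) (hW0 a))
  have he1 : e ≤ 1 := by
    rw [← hp1]
    exact Finset.sum_le_sum (fun a _ => mul_le_of_le_one_right (hp a) (hW1 a))
  have hpt : ∀ a, p a * Real.exp (u * (W a - e))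
      ≤ p a + u * (p a * W a) - u * e * p a + u^2 * ((1 - 2 * e) * (p a * W a) + e^2 * p a) := by
    intro a
    have hz : |u * (W a - e)| ≤ 1 := by
      rw [abs_mul]
      have : |W a - e| ≤ 1 := by
        rw [abs_le]; constructor <;> linarith [hW0 a, hW1 a]
      exact mul_le_one₀ hu (abs_nonneg _) this
    have h1 := (abs_le.mp (Real.abs_exp_sub_one_sub_id_le hz)).2
    have h2 : (W a - e)^2 ≤ (1 - 2 * e) * W a + e^2 := by nlinarith [hW0 a, hW1 a]
    have h3 : Real.exp (u * (W a - e)) ≤ 1 + u * (W a - e) + u^2 * ((1 - 2 * e) * W a + e^2) := by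
      have := mul_le_mul_of_nonneg_left h2 (sq_nonneg u)
      rw [← mul_pow] at this
      linarith
    have := mul_le_mul_of_nonneg_left h3 (hp a)
    linarith
  have hs := Finset.sum_le_sum (fun a (_ : a ∈ Finset.univ) => hpt a)
  have : ∑ a, (p a + u * (p a * W a) - u * e * p a
      + u^2 * ((1 - 2 * e) * (p a * W a) + e^2 * p a)) = 1 + u^2 * (e - e^2) := by
    simp only [Finset.sum_add_distrib, Finset.sum_sub_distrib, ← Finset.mul_sum, ← he, hp1]
    ring
  rw [this] at hs
  have h5 : u^2 * (e - e^2) ≤ u^2 / 4 := by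
    nlinarith [mul_nonneg (sq_nonneg u) (sq_nonneg (e - 1/2))]
  have := Real.add_one_le_exp (u^2/4)
  linarith

lemma mgf_pi {α : Type*} [Fintype α] (t : ℕ) (p W : α → ℝ) (hp : ∀ a, 0 ≤ p a)
    (hp1 : ∑ a, p a = 1)
    (hW0 : ∀ a, 0 ≤ W a) (hW1 : ∀ a, W a ≤ 1) (u : ℝ) (hu : |u| ≤ 1) :
    ∑ m : Fin t → α, (∏ i, p (m i)) * Real.exp (u * ∑ i, (W (m i) - ∑ c, p c * W c))
      ≤ Real.exp (t * (u ^ 2 / 4)) := by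
  have h1 : ∀ m : Fin t → α, (∏ i, p (m i)) * Real.exp (u * ∑ i, (W (m i) - ∑ c, p c * W c))
      = ∏ i, (p (m i) * Real.exp (u * (W (m i) - ∑ c, p c * W c))) := by
    intro m
    rw [Finset.prod_mul_distrib, Finset.mul_sum, Real.exp_sum]
  simp_rw [h1]
  rw [sum_pi_prod t (fun _ a => p a * Real.exp (u * (W a - ∑ c, p c * W c)))]
  simp only [Finset.prod_const, Finset.card_univ, Fintype.card_fin]
  rw [Real.exp_nat_mul]
  exact pow_le_pow_left₀ (Finset.sum_nonneg fun a _ => mul_nonneg (hp a) (Real.exp_pos _).le)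
    (mgf_one p W hp hp1 hW0 hW1 u hu) t


noncomputable def mix {X U : Type*} [Fintype X] (P : X → U → ℝ) (u : U) : ℝ :=
  ∑ x, (Fintype.card X : ℝ)⁻¹ * P x u

noncomputable def kl {X U : Type*} [Fintype X] [Fintype U] (P : X → U → ℝ) (x : X) : ℝ :=
  ∑ u, P x u * (Real.log (P x u) - Real.log (mix P u))

noncomputable def info {X U : Type*} [Fintype X] [Fintype U] (P : X → U → ℝ) : ℝ :=
  ∑ x, (Fintype.card X : ℝ)⁻¹ * kl P x

section
variable {X U : Type*} [Fintype X] [Fintype U] [Nonempty X] (P : X → U → ℝ)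

lemma card_pos_real : (0 : ℝ) < Fintype.card X := by exact_mod_cast Fintype.card_pos

lemma mix_nonneg (hp : ∀ x u, 0 ≤ P x u) (u : U) : 0 ≤ mix P u :=
  Finset.sum_nonneg fun x _ => mul_nonneg (inv_nonneg.mpr (Nat.cast_nonneg _)) (hp x u)

lemma mix_zero (hp : ∀ x u, 0 ≤ P x u) (x : X) (u : U) (h : mix P u = 0) : P x u = 0 := by
  unfold mix at h
  have h1 := (Finset.sum_eq_zero_iff_of_nonneg (fun x _ =>
    mul_nonneg (inv_nonneg.mpr (Nat.cast_nonneg _)) (hp x u))).mp h x (Finset.mem_univ _)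
  rcases mul_eq_zero.mp h1 with h2 | h2
  · exact absurd h2 (inv_ne_zero (card_pos_real (X := X)).ne')
  · exact h2

lemma mix_sum (hp1 : ∀ x, ∑ u, P x u = 1) : ∑ u, mix P u = 1 := by
  unfold mix
  rw [Finset.sum_comm]
  simp_rw [← Finset.mul_sum, hp1]
  simp

lemma kl_dv (hp : ∀ x u, 0 ≤ P x u) (hp1 : ∀ x, ∑ u, P x u = 1) (x : X) (φ : U → ℝ) :
    ∑ u, P x u * φ u ≤ kl P x + Real.log (∑ u, mix P u * Real.exp (φ u)) := by
  have h := dv (P x) (mix P) (fun u => Real.log (P x u) - Real.log (mix P u)) φ (hp x) (hp1 x)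
    (fun u => tilt_le (hp x u) (mix_nonneg P hp u) (mix_zero P hp x u))
  simp_rw [mul_sub (P x _) (φ _)] at h
  rw [Finset.sum_sub_distrib] at h
  unfold kl
  linarith

lemma kl_nonneg (hp : ∀ x u, 0 ≤ P x u) (hp1 : ∀ x, ∑ u, P x u = 1) (x : X) : 0 ≤ kl P x := by
  have h := kl_dv P hp hp1 x (fun _ => 0)
  simp [mix_sum P hp1] at h
  exact h

lemma info_nonneg (hp : ∀ x u, 0 ≤ P x u) (hp1 : ∀ x, ∑ u, P x u = 1) : 0 ≤ info P :=
  Finset.sum_nonneg fun x _ => mul_nonneg (inv_nonneg.mpr (Nat.cast_nonneg _)) (kl_nonneg P hp hp1 x)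

/-- Fano-type bound: disjoint events `G x` on `t` samples. -/
lemma fano (hp : ∀ x u, 0 ≤ P x u) (hp1 : ∀ x, ∑ u, P x u = 1) (t : ℕ)
    (G : X → (Fin t → U) → Prop) (hdisj : ∀ m x x', G x m → G x' m → x = x') :
    Real.log (Fintype.card X) * (∑ x, (Fintype.card X : ℝ)⁻¹ *
        ∑ m : Fin t → U, (∏ i, P x (m i)) * (if G x m then 1 else 0))
      ≤ t * info P + Real.log 2 := by
  set N : ℝ := ((Fintype.card X : ℕ) : ℝ) with hN
  have hNpos : 0 < N := card_pos_real
  have hprodsum : ∀ x, ∑ m : Fin t → U, ∏ i, P x (m i) = 1 := by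
    intro x
    rw [sum_pi_prod t (fun _ a => P x a)]
    simp [hp1]
  have hmixsum : ∑ m : Fin t → U, ∏ i, mix P (m i) = 1 := by
    rw [sum_pi_prod t (fun _ a => mix P a)]
    simp [mix_sum P hp1]
  have h := dv (α := X × (Fin t → U)) (fun a => N⁻¹ * ∏ i, P a.1 (a.2 i))
    (fun a => N⁻¹ * ∏ i, mix P (a.2 i))
    (fun a => ∑ i, (Real.log (P a.1 (a.2 i)) - Real.log (mix P (a.2 i))))
    (fun a => Real.log N * (if G a.1 a.2 then 1 else 0))
    (fun a => mul_nonneg (inv_nonneg.mpr hNpos.le) (Finset.prod_nonneg fun i _ => hp _ _))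
    (by
      rw [Fintype.sum_prod_type]
      simp only [← Finset.mul_sum, hprodsum]
      simp [hN])
    (by
      rintro ⟨x, m⟩
      simp only
      rw [mul_assoc]
      apply mul_le_mul_of_nonneg_left _ (inv_nonneg.mpr hNpos.le)
      rw [← Finset.sum_neg_distrib, Real.exp_sum, ← Finset.prod_mul_distrib]
      exact Finset.prod_le_prod (fun i _ => mul_nonneg (hp _ _) (Real.exp_pos _).le)
        (fun i _ => tilt_le (hp x _) (mix_nonneg P hp _) (mix_zero P hp x _)))
  simp only [mul_sub] at h
  rw [Finset.sum_sub_distrib, Fintype.sum_prod_type, Fintype.sum_prod_type,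
    Fintype.sum_prod_type] at h
  simp only at h
  have hA : ∑ x, ∑ m : Fin t → U, N⁻¹ * (∏ i, P x (m i)) *
      ∑ i, (Real.log (P x (m i)) - Real.log (mix P (m i))) = t * info P := by
    simp only [mul_assoc, ← Finset.mul_sum]
    unfold info kl
    rw [← hN, Finset.mul_sum, Finset.mul_sum]
    apply Finset.sum_congr rfl
    intro x _
    rw [sum_pi_marg t (P x) (fun u => Real.log (P x u) - Real.log (mix P u)) (hp1 x)]
    ring
  have hB : ∑ x, ∑ m : Fin t → U, N⁻¹ * (∏ i, P x (m i)) *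
      (Real.log N * (if G x m then 1 else 0)) = Real.log N * (∑ x, N⁻¹ *
        ∑ m : Fin t → U, (∏ i, P x (m i)) * (if G x m then 1 else 0)) := by
    simp only [Finset.mul_sum]
    refine Finset.sum_congr rfl fun x _ => Finset.sum_congr rfl fun m _ => ?_
    ring
  have hC : ∑ x, ∑ m : Fin t → U, N⁻¹ * (∏ i, mix P (m i)) *
      Real.exp (Real.log N * (if G x m then 1 else 0)) ≤ 2 := by
    rw [Finset.sum_comm]
    have : ∀ m : Fin t → U, ∑ x, N⁻¹ * (∏ i, mix P (m i)) *
        Real.exp (Real.log N * (if G x m then 1 else 0)) ≤ 2 * ∏ i, mix P (m i) := by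
      intro m
      have hq : 0 ≤ ∏ i, mix P (m i) := Finset.prod_nonneg fun i _ => mix_nonneg P hp _
      have h1 : ∑ x, Real.exp (Real.log N * (if G x m then 1 else 0)) ≤ 2 * N := by
        have h2 : ∀ x, Real.exp (Real.log N * (if G x m then 1 else 0))
            ≤ 1 + N * (if G x m then 1 else 0) := by
          intro x
          split_ifs
          · simp [Real.exp_log hNpos]
          · simp
        refine (Finset.sum_le_sum fun x _ => h2 x).trans ?_
        rw [Finset.sum_add_distrib, ← Finset.mul_sum]
        have h3 : ∑ x, (if G x m then (1 : ℝ) else 0) ≤ 1 := by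
          rw [Finset.sum_boole]
          have : (Finset.univ.filter fun x => G x m).card ≤ 1 := by
            rw [Finset.card_le_one]
            intro x hx x' hx'
            exact hdisj m x x' (Finset.mem_filter.mp hx).2 (Finset.mem_filter.mp hx').2
          exact_mod_cast this
        simp only [Finset.sum_const, Finset.card_univ, nsmul_eq_mul, mul_one, ← hN]
        nlinarith
      rw [← Finset.mul_sum]
      calc N⁻¹ * (∏ i, mix P (m i)) * ∑ x, Real.exp (Real.log N * (if G x m then 1 else 0))
          ≤ N⁻¹ * (∏ i, mix P (m i)) * (2 * N) :=
            mul_le_mul_of_nonneg_left h1 (mul_nonneg (inv_nonneg.mpr hNpos.le) hq)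
        _ = 2 * ∏ i, mix P (m i) := by field_simp
    refine (Finset.sum_le_sum fun m _ => this m).trans ?_
    rw [← Finset.mul_sum, hmixsum, mul_one]
  rw [hA, hB] at h
  have hD : 0 < ∑ x, ∑ m : Fin t → U, N⁻¹ * (∏ i, mix P (m i)) *
      Real.exp (Real.log N * (if G x m then 1 else 0)) := by
    have h1 : ∑ x : X, ∑ m : Fin t → U, N⁻¹ * (∏ i, mix P (m i)) = 1 := by
      simp only [← Finset.mul_sum, hmixsum]
      simp [hN]
    refine lt_of_lt_of_le one_pos (h1.symm.le.trans ?_)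
    refine Finset.sum_le_sum fun x _ => Finset.sum_le_sum fun m _ => ?_
    apply le_mul_of_one_le_right
    · exact mul_nonneg (inv_nonneg.mpr hNpos.le) (Finset.prod_nonneg fun i _ => mix_nonneg P hp _)
    · apply Real.one_le_exp
      have : 0 ≤ Real.log N := Real.log_natCast_nonneg _
      split_ifs <;> simp [this]
  have := Real.log_le_log hD hC
  linarith

end

section
variable {X U V : Type*} [Fintype X] [Fintype U] [Fintype V] [Nonempty X]

lemma core (PA : X → U → ℝ) (PB : X → V → ℝ) (W : U → V → ℝ) (γ : ℝ)
    (hA : ∀ x u, 0 ≤ PA x u) (hA1 : ∀ x, ∑ u, PA x u = 1)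
    (hB : ∀ x u, 0 ≤ PB x u) (hB1 : ∀ x, ∑ u, PB x u = 1)
    (hW0 : ∀ u v, 0 ≤ W u v) (hW1 : ∀ u v, W u v ≤ 1) (hγ : 0 < γ) (hγ2 : γ ≤ 1 / 2)
    (hacc : ∀ x, 1 / 2 + γ ≤ ∑ v, PB x v * ∑ u, PA x u * W u v)
    (hrej : ∀ x y, x ≠ y → ∑ v, PB y v * ∑ u, PA x u * W u v ≤ 1 / 2 - γ) :
    γ ^ 2 * (Real.log (Fintype.card X) / 4 - Real.log 2) ≤ info PA * (2 * info PB + 2) := by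
  set a := info PA with ha
  set b := info PB with hb
  have ha0 : 0 ≤ a := info_nonneg PA hA hA1
  have hb0 : 0 ≤ b := info_nonneg PB hB hB1
  set N : ℝ := ((Fintype.card X : ℕ) : ℝ) with hN
  have hNpos : 0 < N := card_pos_real
  set t : ℕ := ⌊(2 * b + Real.log 4) / γ ^ 2⌋₊ + 1 with ht
  have hl4 : Real.log 4 = 2 * Real.log 2 := by
    rw [show (4 : ℝ) = 2 ^ 2 by norm_num, Real.log_pow]; norm_num
  have hl2 := Real.log_two_lt_d9
  have hl2' := Real.log_two_gt_d9
  have hγsq : 0 < γ ^ 2 := by positivity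
  have ht1 : 2 * b + Real.log 4 < t * γ ^ 2 := by
    rw [← div_lt_iff₀ hγsq, ht]
    push_cast
    exact Nat.lt_floor_add_one _
  have ht2 : t * γ ^ 2 ≤ 2 * b + 2 := by
    have h0 : 0 ≤ (2 * b + Real.log 4) / γ ^ 2 := by
      apply div_nonneg _ hγsq.le
      linarith
    have h1 := Nat.floor_le h0
    rw [le_div_iff₀ hγsq] at h1
    rw [ht]; push_cast
    nlinarith
  have htpos : (0 : ℝ) < t := by rw [ht]; positivity
  set e : X → V → ℝ := fun x v => ∑ c, PA x c * W c v with he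
  set h : X → (Fin t → U) → V → ℝ := fun x m v => ∑ i, (W (m i) v - e x v) with hh
  set Z : X → (Fin t → U) → ℝ := fun x m =>
    ∑ v, mix PB v * (Real.exp (2 * γ * h x m v) + Real.exp (-(2 * γ) * h x m v)) with hZ
  set E := Real.exp (t * γ ^ 2) with hE
  have hEpos : 0 < E := Real.exp_pos _
  have hQ := mix_nonneg PB hB
  have hQ1 := mix_sum PB hB1
  have hZ0 : ∀ x m, 0 ≤ Z x m := fun x m => Finset.sum_nonneg fun v _ =>
    mul_nonneg (hQ v) (add_nonneg (Real.exp_pos _).le (Real.exp_pos _).le)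
  have hmgf : ∀ x v u, u ^ 2 = 4 * γ ^ 2 → |u| ≤ 1 →
      ∑ m : Fin t → U, (∏ i, PA x (m i)) * Real.exp (u * h x m v) ≤ E := by
    intro x v u hu hu1
    have := mgf_pi t (PA x) (fun a => W a v) (hA x) (hA1 x) (fun a => hW0 a v)
      (fun a => hW1 a v) u hu1
    rw [hu, show (t : ℝ) * (4 * γ ^ 2 / 4) = t * γ ^ 2 by ring] at this
    exact this
  have hEZ : ∀ x, ∑ m : Fin t → U, (∏ i, PA x (m i)) * Z x m ≤ 2 * E := by
    intro x
    have h1 : ∑ m : Fin t → U, (∏ i, PA x (m i)) * Z x m = ∑ v, mix PB v *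
        (∑ m : Fin t → U, (∏ i, PA x (m i)) * Real.exp (2 * γ * h x m v)
          + ∑ m : Fin t → U, (∏ i, PA x (m i)) * Real.exp (-(2 * γ) * h x m v)) := by
      simp only [hZ, Finset.mul_sum, ← Finset.sum_add_distrib]
      rw [Finset.sum_comm]
      refine Finset.sum_congr rfl fun v _ => Finset.sum_congr rfl fun m _ => ?_
      ring
    rw [h1]
    have h2 : ∀ v, mix PB v *
        (∑ m : Fin t → U, (∏ i, PA x (m i)) * Real.exp (2 * γ * h x m v)
          + ∑ m : Fin t → U, (∏ i, PA x (m i)) * Real.exp (-(2 * γ) * h x m v))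
        ≤ mix PB v * (2 * E) := by
      intro v
      apply mul_le_mul_of_nonneg_left _ (hQ v)
      have habs : |2 * γ| ≤ 1 := by rw [abs_of_pos (by linarith)]; linarith
      have i1 := hmgf x v (2 * γ) (by ring) habs
      have i2 := hmgf x v (-(2 * γ)) (by ring) (by rw [abs_neg]; exact habs)
      linarith
    refine (Finset.sum_le_sum fun v _ => h2 v).trans ?_
    rw [← Finset.sum_mul, hQ1, one_mul]
  have hG : ∀ x, 1 / 2 ≤ ∑ m : Fin t → U, (∏ i, PA x (m i)) *
      (if Z x m ≤ 4 * E then 1 else 0) := by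
    intro x
    have hs : ∑ m : Fin t → U, ∏ i, PA x (m i) = 1 := by
      rw [sum_pi_prod t (fun _ a => PA x a)]
      simp [hA1]
    have h1 : ∑ m : Fin t → U, (∏ i, PA x (m i)) * (4 * E - 4 * E *
        (if Z x m ≤ 4 * E then 1 else 0)) ≤ ∑ m : Fin t → U, (∏ i, PA x (m i)) * Z x m := by
      refine Finset.sum_le_sum fun m _ => ?_
      apply mul_le_mul_of_nonneg_left _ (Finset.prod_nonneg fun i _ => hA _ _)
      split_ifs with hc
      · have := hZ0 x m; linarith
      · push Not at hc; linarith
    have h2 : ∑ m : Fin t → U, (∏ i, PA x (m i)) * (4 * E - 4 * E *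
        (if Z x m ≤ 4 * E then 1 else 0)) = 4 * E - 4 * E *
        ∑ m : Fin t → U, (∏ i, PA x (m i)) * (if Z x m ≤ 4 * E then 1 else 0) := by
      simp only [mul_sub, Finset.sum_sub_distrib, ← Finset.sum_mul, hs, one_mul, Finset.mul_sum]
      congr 1
      refine Finset.sum_congr rfl fun m _ => ?_
      ring
    have h3 := hEZ x
    rw [h2] at h1
    by_contra hcon
    push Not at hcon
    nlinarith
  have hdev : ∀ x y m, Z x m ≤ 4 * E → kl PB y ≤ 2 * b →
      ∀ u, u = 2 * γ ∨ u = -(2 * γ) → u * ∑ v, PB y v * h x m v < 2 * t * γ ^ 2 := by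
    intro x y m hZm hy u hu
    have h1 := kl_dv PB hB hB1 y (fun v => u * h x m v)
    have h2 : ∑ v, mix PB v * Real.exp (u * h x m v) ≤ 4 * E := by
      refine le_trans (Finset.sum_le_sum fun v _ => ?_) hZm
      apply mul_le_mul_of_nonneg_left _ (hQ v)
      rcases hu with rfl | rfl
      · have := Real.exp_pos (-(2 * γ) * h x m v); linarith
      · have := Real.exp_pos (2 * γ * h x m v); linarith
    have h3 : Real.log (∑ v, mix PB v * Real.exp (u * h x m v)) ≤ Real.log 4 + t * γ ^ 2 := by
      have hpos : 0 < ∑ v, mix PB v * Real.exp (u * h x m v) := by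
        have : ∃ v, 0 < mix PB v := by
          by_contra hc
          push Not at hc
          have : ∑ v, mix PB v ≤ 0 := Finset.sum_nonpos fun v _ => hc v
          linarith
        obtain ⟨v, hv⟩ := this
        exact Finset.sum_pos' (fun v _ => mul_nonneg (hQ v) (Real.exp_pos _).le)
          ⟨v, Finset.mem_univ _, mul_pos hv (Real.exp_pos _)⟩
      have := Real.log_le_log hpos h2
      rwa [Real.log_mul (by norm_num) hEpos.ne', hE, Real.log_exp] at this
    have h4 : ∑ v, PB y v * (u * h x m v) = u * ∑ v, PB y v * h x m v := by
      rw [Finset.mul_sum]; refine Finset.sum_congr rfl fun v _ => ?_; ring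
    rw [h4] at h1
    linarith
  have hsplit : ∀ x y m, ∑ v, PB y v * h x m v =
      (∑ v, PB y v * ∑ i, W (m i) v) - t * ∑ v, PB y v * ∑ u, PA x u * W u v := by
    intro x y m
    simp only [hh, he, Finset.sum_sub_distrib, Finset.sum_const, Finset.card_univ,
      Fintype.card_fin, nsmul_eq_mul, mul_sub]
    congr 1
    rw [Finset.mul_sum]
    refine Finset.sum_congr rfl fun v _ => ?_
    ring
  have hf := fano PA hA hA1 t (fun x m => Z x m ≤ 4 * E ∧ kl PB x ≤ 2 * b) (by
    rintro m x x' ⟨h1, h2⟩ ⟨h3, h4⟩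
    by_contra hne
    have k1 := hdev x x m h1 h2 (-(2 * γ)) (Or.inr rfl)
    have k2 := hdev x' x m h3 h2 (2 * γ) (Or.inl rfl)
    rw [hsplit] at k1 k2
    set S := ∑ v, PB x v * ∑ i, W (m i) v
    have r1 := hacc x
    have r2 := hrej x' x (Ne.symm hne)
    have k3 : t * (∑ v, PB x v * ∑ u, PA x u * W u v) - S < t * γ := by
      by_contra hc
      push Not at hc
      nlinarith
    have k4 : S - t * (∑ v, PB x v * ∑ u, PA x' u * W u v) < t * γ := by
      by_contra hc
      push Not at hc
      nlinarith
    have k5 := mul_le_mul_of_nonneg_left r1 htpos.le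
    have k6 := mul_le_mul_of_nonneg_left r2 htpos.le
    linarith)
  have hhalf : 1 / 2 ≤ ∑ x, N⁻¹ * (if kl PB x ≤ 2 * b then (1 : ℝ) else 0) := by
    have h1 : ∑ _x : X, N⁻¹ = 1 := by simp [hN]
    rcases hb0.eq_or_lt with h0 | h0
    · have hz : ∀ x, kl PB x = 0 := by
        intro x
        have h2 : info PB = 0 := h0.symm
        unfold info at h2
        have h3 := (Finset.sum_eq_zero_iff_of_nonneg (fun x _ =>
          mul_nonneg (inv_nonneg.mpr (Nat.cast_nonneg _)) (kl_nonneg PB hB hB1 x))).mp h2 x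
            (Finset.mem_univ _)
        rcases mul_eq_zero.mp h3 with h4 | h4
        · exact absurd h4 (inv_ne_zero hNpos.ne')
        · exact h4
      have : ∀ x, (if kl PB x ≤ 2 * b then (1 : ℝ) else 0) = 1 := by
        intro x; rw [if_pos]; rw [hz x]; linarith
      simp only [this, mul_one, h1]
      norm_num
    · have h2 : ∑ x, N⁻¹ * (2 * b - 2 * b * (if kl PB x ≤ 2 * b then (1 : ℝ) else 0)) ≤ b := by
        rw [hb]
        unfold info
        refine Finset.sum_le_sum fun x _ => ?_
        apply mul_le_mul_of_nonneg_left _ (inv_nonneg.mpr hNpos.le)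
        have hk := kl_nonneg PB hB hB1 x
        change 2 * b - 2 * b * (if kl PB x ≤ 2 * b then (1 : ℝ) else 0) ≤ kl PB x
        split_ifs with hc
        · linarith
        · push Not at hc; linarith
      have h3 : ∑ x, N⁻¹ * (2 * b - 2 * b * (if kl PB x ≤ 2 * b then (1 : ℝ) else 0))
          = 2 * b - 2 * b * ∑ x, N⁻¹ * (if kl PB x ≤ 2 * b then (1 : ℝ) else 0) := by
        simp only [mul_sub, Finset.sum_sub_distrib, ← Finset.sum_mul, h1, one_mul,
          Finset.mul_sum]
        congr 1
        refine Finset.sum_congr rfl fun x _ => ?_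
        ring
      rw [h3] at h2
      by_contra hc
      push Not at hc
      nlinarith
  have hquarter : 1 / 4 ≤ ∑ x, N⁻¹ * ∑ m : Fin t → U, (∏ i, PA x (m i)) *
      (if Z x m ≤ 4 * E ∧ kl PB x ≤ 2 * b then 1 else 0) := by
    have : ∀ x, (1 / 2) * (N⁻¹ * (if kl PB x ≤ 2 * b then (1 : ℝ) else 0)) ≤
        N⁻¹ * ∑ m : Fin t → U, (∏ i, PA x (m i)) *
      (if Z x m ≤ 4 * E ∧ kl PB x ≤ 2 * b then 1 else 0) := by
      intro x
      rw [mul_left_comm]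
      apply mul_le_mul_of_nonneg_left _ (inv_nonneg.mpr hNpos.le)
      by_cases hc : kl PB x ≤ 2 * b
      · simp only [hc, and_true, if_true, mul_one]
        exact hG x
      · simp [hc]
    refine le_trans ?_ (Finset.sum_le_sum fun x _ => this x)
    rw [← Finset.mul_sum]
    linarith
  have hlogN : 0 ≤ Real.log N := Real.log_natCast_nonneg _
  have hq2 := mul_le_mul_of_nonneg_left hquarter hlogN
  have hfin : Real.log N / 4 - Real.log 2 ≤ t * a := by
    have hq3 := hq2.trans (le_of_eq_of_le (by congr!) hf)
    linarith
  calc γ ^ 2 * (Real.log N / 4 - Real.log 2) ≤ γ ^ 2 * (t * a) :=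
        mul_le_mul_of_nonneg_left hfin hγsq.le
    _ = a * (t * γ ^ 2) := by ring
    _ ≤ a * (2 * b + 2) := mul_le_mul_of_nonneg_left ht2 ha0

end


section Entropy

lemma negMulLog_le_one {q : ℝ} (h0 : 0 ≤ q) : Real.negMulLog q ≤ 1 := by
  rcases h0.eq_or_lt with h | h
  · rw [← h]; simp
  · have h1 := Real.one_sub_inv_le_log_of_pos h
    have h2 := mul_le_mul_of_nonneg_left h1 h.le
    rw [mul_sub, mul_inv_cancel₀ h.ne'] at h2
    unfold Real.negMulLog
    linarith

variable {Ω : Type} [Fintype Ω]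

lemma probVal_nonneg {α : Type*} (p : FinDist Ω) (A : Ω → α) (a : α) : 0 ≤ p.probVal A a := by
  unfold FinDist.probVal FinDist.probEvent
  refine Finset.sum_nonneg fun ω _ => ?_
  split_ifs
  · exact p.nonneg ω
  · exact le_rfl

lemma probVal_le_one {α : Type*} (p : FinDist Ω) (A : Ω → α) (a : α) : p.probVal A a ≤ 1 := by
  unfold FinDist.probVal FinDist.probEvent
  rw [← p.sum_one]
  refine Finset.sum_le_sum fun ω _ => ?_
  split_ifs
  · exact le_rfl
  · exact p.nonneg ω

lemma entropy_eq {α : Type*} [Fintype α] (p : FinDist Ω) (A : Ω → α) :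
    p.entropy A = (∑ a, Real.negMulLog (p.probVal A a)) / Real.log 2 := by
  unfold FinDist.entropy
  rw [Finset.sum_div]
  have h1 : ∀ a, -(p.probVal A a * Real.logb 2 (p.probVal A a))
      = Real.negMulLog (p.probVal A a) / Real.log 2 := by
    intro a
    unfold Real.negMulLog Real.logb
    ring
  simp_rw [h1]
  apply Finset.sum_subset (Finset.subset_univ _)
  intro a _ ha
  have : p.probVal A a = 0 := by
    unfold FinDist.probVal FinDist.probEvent
    refine Finset.sum_eq_zero fun ω _ => ?_
    rw [if_neg]
    intro h
    exact ha (Finset.mem_image.mpr ⟨ω, Finset.mem_univ _, h⟩)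
  simp [this]

lemma entropy_nonneg {α : Type*} [Fintype α] (p : FinDist Ω) (A : Ω → α) : 0 ≤ p.entropy A := by
  rw [entropy_eq]
  exact div_nonneg (Finset.sum_nonneg fun a _ =>
    Real.negMulLog_nonneg (probVal_nonneg p A a) (probVal_le_one p A a)) (Real.log_nonneg (by norm_num))

lemma entropy_le {α : Type*} [Fintype α] (p : FinDist Ω) (A : Ω → α) :
    p.entropy A ≤ Fintype.card α / Real.log 2 := by
  rw [entropy_eq]
  apply div_le_div_of_nonneg_right _ (Real.log_nonneg (by norm_num))
  refine (Finset.sum_le_sum fun a _ => negMulLog_le_one (probVal_nonneg p A a)).trans ?_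
  simp

lemma probVal_fst {α β : Type*} [Fintype β] (p : FinDist Ω) (A : Ω → α) (B : Ω → β) (a : α) :
    p.probVal A a = ∑ b, p.probVal (fun ω => (A ω, B ω)) (a, b) := by
  unfold FinDist.probVal FinDist.probEvent
  rw [Finset.sum_comm]
  refine Finset.sum_congr rfl fun ω _ => ?_
  by_cases h : A ω = a <;> simp [h]

lemma probVal_snd {α β : Type*} [Fintype α] (p : FinDist Ω) (A : Ω → α) (B : Ω → β) (b : β) :
    p.probVal B b = ∑ a, p.probVal (fun ω => (A ω, B ω)) (a, b) := by
  unfold FinDist.probVal FinDist.probEvent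
  rw [Finset.sum_comm]
  refine Finset.sum_congr rfl fun ω _ => ?_
  by_cases h : B ω = b <;> simp [h]

lemma H2 {α β : Type*} [Fintype α] [Fintype β] (p : α → ℝ) (q : β → ℝ)
    (hp : ∑ a, p a = 1) (hq : ∑ a, q a = 1) :
    ∑ a, ∑ b, Real.negMulLog (p a * q b)
      = ∑ a, Real.negMulLog (p a) + ∑ b, Real.negMulLog (q b) := by
  simp only [Real.negMulLog_mul, Finset.sum_add_distrib, ← Finset.sum_mul, ← Finset.mul_sum, hp, hq,
    one_mul]

lemma H3 {α β κ : Type*} [Fintype α] [Fintype β] [Fintype κ] (p : α → ℝ) (q : β → ℝ) (r : κ → ℝ)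
    (hp : ∑ a, p a = 1) (hq : ∑ a, q a = 1) (hr : ∑ a, r a = 1) :
    ∑ a, ∑ b, ∑ c, Real.negMulLog (p a * q b * r c)
      = ∑ a, Real.negMulLog (p a) + ∑ b, Real.negMulLog (q b) + ∑ c, Real.negMulLog (r c) := by
  have hpq : ∑ x : α × β, p x.1 * q x.2 = 1 := by
    rw [Fintype.sum_prod_type]; simp only [← Finset.mul_sum, hq, mul_one, hp]
  have h := H2 (fun x : α × β => p x.1 * q x.2) r hpq hr
  rw [Fintype.sum_prod_type, Fintype.sum_prod_type] at h
  simp only at h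
  rw [h, H2 p q hp hq]

lemma sum3 {α β κ : Type*} [Fintype α] [Fintype β] [Fintype κ] (p : α → ℝ) (q : β → ℝ) (r : κ → ℝ)
    (hp : ∑ a, p a = 1) (hq : ∑ a, q a = 1) (hr : ∑ a, r a = 1) :
    ∑ a, ∑ b, ∑ c, p a * q b * r c = 1 := by
  simp only [← Finset.mul_sum, hr, hq, mul_one, hp]

lemma info_eq {X U : Type*} [Fintype X] [Fintype U] (P : X → U → ℝ) :
    info P = ∑ u, Real.negMulLog (mix P u)
      - ∑ x, (Fintype.card X : ℝ)⁻¹ * ∑ u, Real.negMulLog (P x u) := by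
  have h1 : ∑ u, Real.negMulLog (mix P u)
      = -∑ x, (Fintype.card X : ℝ)⁻¹ * ∑ u, P x u * Real.log (mix P u) := by
    simp only [Finset.mul_sum]
    rw [Finset.sum_comm, ← Finset.sum_neg_distrib]
    refine Finset.sum_congr rfl fun u _ => ?_
    unfold Real.negMulLog
    have hm : mix P u * Real.log (mix P u)
        = ∑ x, (Fintype.card X : ℝ)⁻¹ * P x u * Real.log (mix P u) := by
      rw [← Finset.sum_mul, mix]
    rw [neg_mul, hm]
    congr 1
    refine Finset.sum_congr rfl fun x _ => ?_
    ring
  rw [h1]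
  unfold info kl Real.negMulLog
  rw [← Finset.sum_neg_distrib, ← Finset.sum_sub_distrib]
  refine Finset.sum_congr rfl fun x _ => ?_
  simp only [mul_sub, Finset.sum_sub_distrib, neg_mul, Finset.sum_neg_distrib]
  ring

end Entropy

section Protocol

variable {X Y Z : Type} [Fintype X] [Fintype Y] [Fintype Z] (P : ShSMP X Y Z)

noncomputable def PA (x : X) (u : P.MA × P.RAC) : ℝ :=
  ∑ ra, if P.pA x ra u.2 = u.1 then P.dRA.prob ra * P.dRAC.prob u.2 else 0

noncomputable def PB (y : Y) (u : P.MB × P.RBC) : ℝ :=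
  ∑ rb, if P.pB y rb u.2 = u.1 then P.dRB.prob rb * P.dRBC.prob u.2 else 0

lemma PA_nonneg (x : X) (u : P.MA × P.RAC) : 0 ≤ PA P x u :=
  Finset.sum_nonneg fun ra _ => by
    split_ifs
    · exact mul_nonneg (P.dRA.nonneg _) (P.dRAC.nonneg _)
    · exact le_rfl

lemma PB_nonneg (x : Y) (u : P.MB × P.RBC) : 0 ≤ PB P x u :=
  Finset.sum_nonneg fun ra _ => by
    split_ifs
    · exact mul_nonneg (P.dRB.nonneg _) (P.dRBC.nonneg _)
    · exact le_rfl

lemma PA_exp (x : X) (F : P.MA × P.RAC → ℝ) : ∑ u, PA P x u * F u =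
    ∑ ra, ∑ r, P.dRA.prob ra * P.dRAC.prob r * F (P.pA x ra r, r) := by
  unfold PA
  simp only [Finset.sum_mul]
  rw [Finset.sum_comm]
  refine Finset.sum_congr rfl fun ra _ => ?_
  rw [Fintype.sum_prod_type, Finset.sum_comm]
  refine Finset.sum_congr rfl fun r _ => ?_
  simp only [ite_mul, zero_mul]
  simp

lemma PB_exp (x : Y) (F : P.MB × P.RBC → ℝ) : ∑ u, PB P x u * F u =
    ∑ ra, ∑ r, P.dRB.prob ra * P.dRBC.prob r * F (P.pB x ra r, r) := by
  unfold PB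
  simp only [Finset.sum_mul]
  rw [Finset.sum_comm]
  refine Finset.sum_congr rfl fun ra _ => ?_
  rw [Fintype.sum_prod_type, Finset.sum_comm]
  refine Finset.sum_congr rfl fun r _ => ?_
  simp only [ite_mul, zero_mul]
  simp

lemma PA_sum (x : X) : ∑ u, PA P x u = 1 := by
  have := PA_exp P x (fun _ => 1)
  simp only [mul_one] at this
  rw [this]
  simp only [← Finset.mul_sum, P.dRAC.sum_one, mul_one, P.dRA.sum_one]

lemma PB_sum (x : Y) : ∑ u, PB P x u = 1 := by
  have := PB_exp P x (fun _ => 1)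
  simp only [mul_one] at this
  rw [this]
  simp only [← Finset.mul_sum, P.dRBC.sum_one, mul_one, P.dRB.sum_one]

lemma joint_eq (μ : FinDist (X × Y)) (x : X) (y : Y) (mA : P.MA) (mB : P.MB) (c : P.RC)
    (rA : P.RAC) (rB : P.RBC) :
    (P.space μ).probVal (fun ω => (ω.1, (P.rvMA ω, P.rvMB ω, P.rvRC ω, P.rvRAC ω, P.rvRBC ω)))
      ((x, y), (mA, mB, c, rA, rB))
      = μ.prob (x, y) * (PA P x (mA, rA) * PB P y (mB, rB) * P.dRC.prob c) := by
  unfold FinDist.probVal FinDist.probEvent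
  rw [Fintype.sum_prod_type]
  rw [Finset.sum_eq_single (x, y)]
  · simp only [ShSMP.space, ShSMP.randDist, FinDist.prod, ShSMP.rvMA, ShSMP.rvMB, ShSMP.rvRC,
      ShSMP.rvRAC, ShSMP.rvRBC, Prod.mk.injEq, true_and, Fintype.sum_prod_type]
    have h1 : ∀ (ra : P.RA) (rb : P.RB),
        ∑ c' : P.RC, ∑ a' : P.RAC, ∑ b' : P.RBC,
          (if P.pA x ra a' = mA ∧ P.pB y rb b' = mB ∧ c' = c ∧ a' = rA ∧ b' = rB then
            μ.prob (x, y) * (P.dRA.prob ra * (P.dRB.prob rb *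
              (P.dRC.prob c' * (P.dRAC.prob a' * P.dRBC.prob b')))) else 0)
        = μ.prob (x, y) * ((if P.pA x ra rA = mA then P.dRA.prob ra * P.dRAC.prob rA else 0)
          * (if P.pB y rb rB = mB then P.dRB.prob rb * P.dRBC.prob rB else 0) * P.dRC.prob c) := by
      intro ra rb
      rw [Finset.sum_eq_single c, Finset.sum_eq_single rA, Finset.sum_eq_single rB]
      · by_cases k1 : P.pA x ra rA = mA <;> by_cases k2 : P.pB y rb rB = mB <;> simp [k1, k2]
        left; ring
      · intro b' _ hb; rw [if_neg]; tauto
      · simp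
      · intro b' _ hb
        refine Finset.sum_eq_zero fun _ _ => ?_
        rw [if_neg]; tauto
      · simp
      · intro b' _ hb
        refine Finset.sum_eq_zero fun _ _ => Finset.sum_eq_zero fun _ _ => ?_
        rw [if_neg]; tauto
      · simp
    simp only [h1]
    unfold PA PB
    simp only [Finset.sum_mul, Finset.mul_sum]
    exact Finset.sum_comm
  · intro xy _ hxy
    refine Finset.sum_eq_zero fun r _ => ?_
    rw [if_neg]
    intro h
    exact hxy (Prod.mk.inj h).1
  · simp

lemma sum_reorder {A B C D E : Type*} [Fintype A] [Fintype B] [Fintype C] [Fintype D] [Fintype E]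
    (F : A × D → B × E → C → ℝ) :
    ∑ w : A × B × C × D × E, F (w.1, w.2.2.2.1) (w.2.1, w.2.2.2.2) w.2.2.1
      = ∑ u, ∑ v, ∑ c, F u v c := by
  have h : ∑ u, ∑ v, ∑ c, F u v c = ∑ z : (A × D) × (B × E) × C, F z.1 z.2.1 z.2.2 := by
    simp only [Fintype.sum_prod_type]
  rw [h]
  exact Fintype.sum_equiv
    { toFun := fun w => ((w.1, w.2.2.2.1), (w.2.1, w.2.2.2.2), w.2.2.1)
      invFun := fun z => (z.1.1, z.2.1.1, z.2.2, z.1.2, z.2.1.2)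
      left_inv := fun _ => rfl
      right_inv := fun _ => rfl } _ _ (fun _ => rfl)

end Protocol

section Final

variable {X Z : Type} [Fintype X] [Fintype Z] [Nonempty X] (P : ShSMP X X Z)

noncomputable def unif (X : Type) [Fintype X] [Nonempty X] : FinDist (X × X) where
  prob := fun _ => (Fintype.card X : ℝ)⁻¹ * (Fintype.card X : ℝ)⁻¹
  nonneg := fun _ => by positivity
  sum_one := by
    have h := (card_pos_real (X := X)).ne'
    simp
    field_simp

lemma IL_unif : P.IL (unif X) * Real.log 2 = info (PA P) + info (PB P) := by
  have hl : Real.log 2 ≠ 0 := (Real.log_pos (by norm_num)).ne'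
  unfold ShSMP.IL FinDist.mutualInfo
  rw [entropy_eq, entropy_eq, entropy_eq, ← add_div, ← sub_div, div_mul_cancel₀ _ hl]
  set k : ℝ := (Fintype.card X : ℝ)⁻¹ with hk
  have hk1 : ∑ _x : X, k = 1 := by simp [hk]
  have hj : ∀ z : (X × X) × (P.MA × P.MB × P.RC × P.RAC × P.RBC),
      (P.space (unif X)).probVal
        (fun ω => (ω.1, (P.rvMA ω, P.rvMB ω, P.rvRC ω, P.rvRAC ω, P.rvRBC ω))) z
      = k * k * (PA P z.1.1 (z.2.1, z.2.2.2.2.1) * PB P z.1.2 (z.2.2.1, z.2.2.2.2.2)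
          * P.dRC.prob z.2.2.2.1) := by
    rintro ⟨⟨x, y⟩, mA, mB, c, rA, rB⟩
    exact joint_eq P (unif X) x y mA mB c rA rB
  have hXY : ∀ xy : X × X, (P.space (unif X)).probVal (fun ω => ω.1) xy = k * k := by
    intro xy
    rw [probVal_fst _ _ (fun ω => (P.rvMA ω, P.rvMB ω, P.rvRC ω, P.rvRAC ω, P.rvRBC ω))]
    simp only [hj]
    rw [← Finset.mul_sum, sum_reorder (fun u v c => PA P xy.1 u * PB P xy.2 v * P.dRC.prob c),
      sum3 _ _ _ (PA_sum P _) (PB_sum P _) P.dRC.sum_one, mul_one]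
  have hWv : ∀ w : P.MA × P.MB × P.RC × P.RAC × P.RBC, (P.space (unif X)).probVal
        (fun ω => (P.rvMA ω, P.rvMB ω, P.rvRC ω, P.rvRAC ω, P.rvRBC ω)) w
      = mix (PA P) (w.1, w.2.2.2.1) * mix (PB P) (w.2.1, w.2.2.2.2) * P.dRC.prob w.2.2.1 := by
    intro w
    rw [probVal_snd _ (fun ω => ω.1)]
    simp only [hj]
    rw [Fintype.sum_prod_type]
    unfold mix
    rw [Finset.sum_mul_sum, Finset.sum_mul]
    refine Finset.sum_congr rfl fun x _ => ?_
    rw [Finset.sum_mul]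
    refine Finset.sum_congr rfl fun y _ => ?_
    simp only [← hk]
    ring
  simp only [hj, hXY, hWv]
  rw [sum_reorder (fun u v c => Real.negMulLog (mix (PA P) u * mix (PB P) v * P.dRC.prob c)),
    H3 _ _ _ (mix_sum _ (PA_sum P)) (mix_sum _ (PB_sum P)) P.dRC.sum_one]
  have hJ : ∑ z : (X × X) × (P.MA × P.MB × P.RC × P.RAC × P.RBC),
      Real.negMulLog (k * k * (PA P z.1.1 (z.2.1, z.2.2.2.2.1) * PB P z.1.2 (z.2.2.1, z.2.2.2.2.2)
          * P.dRC.prob z.2.2.2.1))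
      = ∑ _xy : X × X, Real.negMulLog (k * k)
        + ((∑ x, k * ∑ u, Real.negMulLog (PA P x u)) + (∑ x, k * ∑ u, Real.negMulLog (PB P x u))
          + ∑ c, Real.negMulLog (P.dRC.prob c)) := by
    rw [Fintype.sum_prod_type]
    have h1 : ∀ xy : X × X, ∑ w : P.MA × P.MB × P.RC × P.RAC × P.RBC,
        Real.negMulLog (k * k * (PA P xy.1 (w.1, w.2.2.2.1) * PB P xy.2 (w.2.1, w.2.2.2.2)
          * P.dRC.prob w.2.2.1))
        = Real.negMulLog (k * k) + k * k * (∑ u, Real.negMulLog (PA P xy.1 u)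
          + ∑ u, Real.negMulLog (PB P xy.2 u) + ∑ c, Real.negMulLog (P.dRC.prob c)) := by
      intro xy
      simp only [Real.negMulLog_mul (k * k)]
      rw [Finset.sum_add_distrib, ← Finset.sum_mul, ← Finset.mul_sum,
        sum_reorder (fun u v c => PA P xy.1 u * PB P xy.2 v * P.dRC.prob c),
        sum_reorder (fun u v c => Real.negMulLog (PA P xy.1 u * PB P xy.2 v * P.dRC.prob c)),
        sum3 _ _ _ (PA_sum P _) (PB_sum P _) P.dRC.sum_one,
        H3 _ _ _ (PA_sum P _) (PB_sum P _) P.dRC.sum_one, one_mul]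
    simp only [h1]
    rw [Finset.sum_add_distrib]
    congr 1
    rw [Fintype.sum_prod_type]
    simp only [mul_assoc, mul_add, ← Finset.mul_sum, Finset.sum_add_distrib]
    have h2 : ∀ s : ℝ, ∑ _x : X, s = k⁻¹ * s := by intro s; simp [hk]
    have hk0 : k ≠ 0 := inv_ne_zero (card_pos_real (X := X)).ne'
    simp only [h2, ← Finset.mul_sum]
    field_simp
  rw [hJ, info_eq, info_eq]
  simp only [← hk]
  ring

lemma IL_bdd : BddAbove (Set.range fun μ : FinDist (X × X) => P.IL μ) := by
  refine ⟨Fintype.card (X × X) / Real.log 2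
    + Fintype.card (P.MA × P.MB × P.RC × P.RAC × P.RBC) / Real.log 2, ?_⟩
  rintro _ ⟨μ, rfl⟩
  simp only [ShSMP.IL, FinDist.mutualInfo]
  have h1 := entropy_le (P.space μ) (fun ω => ω.1)
  have h2 := entropy_le (P.space μ)
    (fun ω => (P.rvMA ω, P.rvMB ω, P.rvRC ω, P.rvRAC ω, P.rvRBC ω))
  have h3 := entropy_nonneg (P.space μ)
    (fun ω => (ω.1, (P.rvMA ω, P.rvMB ω, P.rvRC ω, P.rvRAC ω, P.rvRBC ω)))
  linarith

/-- Acceptance probability given the messages. -/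
noncomputable def Wt (P : ShSMP X X Bool) (u : P.MA × P.RAC) (v : P.MB × P.RBC) : ℝ :=
  ∑ c, if P.pC u.1 v.1 c u.2 v.2 = true then P.dRC.prob c else 0

lemma Wt_nonneg (P : ShSMP X X Bool) (u : P.MA × P.RAC) (v : P.MB × P.RBC) : 0 ≤ Wt P u v :=
  Finset.sum_nonneg fun c _ => by
    split_ifs
    · exact P.dRC.nonneg _
    · exact le_rfl

lemma Wt_le (P : ShSMP X X Bool) (u : P.MA × P.RAC) (v : P.MB × P.RBC) : Wt P u v ≤ 1 := by
  rw [← P.dRC.sum_one]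
  refine Finset.sum_le_sum fun c _ => ?_
  split_ifs
  · exact le_rfl
  · exact P.dRC.nonneg _

lemma acc_eq (P : ShSMP X X Bool) (x y : X) :
    ∑ v, PB P y v * ∑ u, PA P x u * Wt P u v = P.randDist.probEvent
      (fun r => P.pC (P.pA x r.1 r.2.2.2.1) (P.pB y r.2.1 r.2.2.2.2) r.2.2.1 r.2.2.2.1 r.2.2.2.2
        = true) := by
  simp only [PA_exp]
  rw [PB_exp P y (fun v => ∑ ra, ∑ r, P.dRA.prob ra * P.dRAC.prob r * Wt P (P.pA x ra r, r) v)]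
  unfold FinDist.probEvent Wt ShSMP.randDist FinDist.prod
  simp only [Fintype.sum_prod_type, Finset.mul_sum]
  have e1 : ∀ F : P.RB → P.RBC → P.RA → P.RAC → P.RC → ℝ,
      ∑ rb, ∑ b, ∑ ra, ∑ a, ∑ c, F rb b ra a c = ∑ ra, ∑ rb, ∑ c, ∑ a, ∑ b, F rb b ra a c := by
    intro F
    have l : ∑ rb, ∑ b, ∑ ra, ∑ a, ∑ c, F rb b ra a c
        = ∑ z : P.RB × P.RBC × P.RA × P.RAC × P.RC, F z.1 z.2.1 z.2.2.1 z.2.2.2.1 z.2.2.2.2 := by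
      simp only [Fintype.sum_prod_type]
    have r : ∑ ra, ∑ rb, ∑ c, ∑ a, ∑ b, F rb b ra a c
        = ∑ z : P.RA × P.RB × P.RC × P.RAC × P.RBC, F z.2.1 z.2.2.2.2 z.1 z.2.2.2.1 z.2.2.1 := by
      simp only [Fintype.sum_prod_type]
    rw [l, r]
    exact Fintype.sum_equiv
      { toFun := fun z => (z.2.2.1, z.1, z.2.2.2.2, z.2.2.2.1, z.2.1)
        invFun := fun z => (z.2.1, z.2.2.2.2, z.1, z.2.2.2.1, z.2.2.1)
        left_inv := fun _ => rfl
        right_inv := fun _ => rfl } _ _ (fun _ => rfl)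
  rw [e1]
  refine Finset.sum_congr rfl fun ra _ => Finset.sum_congr rfl fun rb _ =>
    Finset.sum_congr rfl fun c _ => Finset.sum_congr rfl fun a _ =>
    Finset.sum_congr rfl fun b _ => ?_
  split_ifs
  · ring
  · simp

lemma probEvent_compl {Ω : Type} [Fintype Ω] (p : FinDist Ω) (A B : Ω → Prop)
    (h : ∀ ω, A ω ↔ ¬ B ω) : p.probEvent A = 1 - p.probEvent B := by
  rw [← p.sum_one]
  unfold FinDist.probEvent
  rw [← Finset.sum_sub_distrib]
  refine Finset.sum_congr rfl fun ω _ => ?_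
  by_cases hB : B ω
  · simp [h, hB]
  · simp [h, hB]

end Final

lemma arith (a b γ δ1 δ2 g s n L : ℝ) (ha : 0 ≤ a) (hb : 0 ≤ b) (hδ1 : 0 < δ1) (hδ2 : 0 < δ2)
    (hγ : 0 < γ - δ1 - δ2) (hγ2 : γ ≤ 1 / 2) (hg0 : 0 ≤ g) (hs0 : 0 ≤ s) (hn : s ^ 2 = n)
    (hL1 : 0.6931 < L) (hL2 : L < 0.6932) (hg : g ^ 2 * L = 2 * (γ - δ1 - δ2) ^ 2)
    (hab : γ ^ 2 * (n * L / 4 - L) ≤ a * (2 * b + 2)) :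
    (δ1 * (2 * g * s) - 20) * L ≤ a + b := by
  have hg1 : g ≤ 1.7 * (γ - δ1 - δ2) := by
    apply le_of_sq_le_sq _ (by positivity)
    nlinarith [sq_nonneg g, sq_nonneg (γ - δ1 - δ2)]
  have h1 : δ1 * g ≤ 0.2125 * γ := by
    have k1 : δ1 * g ≤ δ1 * (1.7 * (γ - δ1 - δ2)) := mul_le_mul_of_nonneg_left hg1 hδ1.le
    have k2 : δ1 * (γ - δ1 - δ2) ≤ γ ^ 2 / 4 := by
      nlinarith [sq_nonneg (γ - 2 * δ1), mul_pos hδ1 hδ2]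
    nlinarith
  have hγ0 : 0 < γ := by linarith
  have h2 : δ1 * (2 * g * s) * L ≤ 0.3 * (γ * s) := by
    have k1 : δ1 * (2 * g * s) ≤ 0.425 * (γ * s) := by nlinarith
    have k0 : 0 ≤ γ * s := by positivity
    nlinarith
  have h3 : 0.3 * (γ * s) ≤ a + b + 13 := by
    apply le_of_sq_le_sq _ (by positivity)
    have k1 : (a + b + 1) ^ 2 ≥ 2 * (a * (2 * b + 2)) := by nlinarith [sq_nonneg (a - b - 1)]
    have k2 : γ ^ 2 * n = (γ * s) ^ 2 := by rw [← hn]; ring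
    have k3 : γ ^ 2 * (n * L / 4 - L) = L * ((γ * s) ^ 2 / 4 - γ ^ 2) := by rw [← k2]; ring
    have k4 : γ ^ 2 ≤ 1 / 4 := by nlinarith
    have k5 : 0.09 * (γ * s) ^ 2 ≤ 2 * (L * ((γ * s) ^ 2 / 4 - γ ^ 2)) + 1 := by
      nlinarith [sq_nonneg (γ * s), sq_nonneg γ]
    nlinarith
  linarith

end EqIL

/-- Information leakage lower bound for equality in the SMP model. -/
theorem il_lower_bound_equality (n : ℕ) (ε δ1 δ2 : ℝ)
    (hε : 0 ≤ ε) (hδ1 : 0 < δ1) (hδ2 : 0 < δ2) (hsum : ε + δ1 + δ2 < 1 / 2)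
    (P : ShSMP (Fin n → Bool) (Fin n → Bool) Bool) (hP : P.Computes (EQfun n) ε) :
    P.ILmax ≥ δ1 * (2 * Real.sqrt (g3 (ε + δ1 + δ2)) * Real.sqrt n
        - g3 (ε + δ1 + δ2) - g2 n n δ2 - 10)
      - 2 * g1 (2 * n) := by
  open EqIL in
  have hγ : 0 < 1 / 2 - ε := by linarith
  have hacc : ∀ x, 1 / 2 + (1 / 2 - ε) ≤ ∑ v, PB P x v * ∑ u, PA P x u * Wt P u v := by
    intro x
    have h := hP x x
    unfold ShSMP.err at h
    have e : EQfun n x x = true := by simp [EQfun]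
    rw [e] at h
    have h2 := probEvent_compl P.randDist (fun r => P.pC (P.pA x r.1 r.2.2.2.1)
      (P.pB x r.2.1 r.2.2.2.2) r.2.2.1 r.2.2.2.1 r.2.2.2.2 = true) _ (fun r => not_not.symm)
    rw [acc_eq, h2]
    change _ ≤ 1 - P.randDist.probEvent (fun r => P.pC (P.pA x r.1 r.2.2.2.1)
      (P.pB x r.2.1 r.2.2.2.2) r.2.2.1 r.2.2.2.1 r.2.2.2.2 ≠ true)
    linarith
  have hrej : ∀ x y, x ≠ y →
      ∑ v, PB P y v * ∑ u, PA P x u * Wt P u v ≤ 1 / 2 - (1 / 2 - ε) := by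
    intro x y hxy
    have h := hP x y
    unfold ShSMP.err at h
    rw [acc_eq]
    have e : EQfun n x y = false := by simp [EQfun, hxy]
    simp only [e, ne_eq, Bool.not_eq_false] at h
    linarith
  have hcore := core (PA P) (PB P) (Wt P) (1 / 2 - ε) (PA_nonneg P) (PA_sum P) (PB_nonneg P)
    (PB_sum P) (Wt_nonneg P) (Wt_le P) hγ (by linarith) hacc hrej
  have hcard : Real.log (Fintype.card (Fin n → Bool)) = n * Real.log 2 := by
    simp [Real.log_pow]
  rw [hcard] at hcore
  have hIL : P.IL (unif (Fin n → Bool)) ≤ P.ILmax := le_ciSup (IL_bdd P) _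
  have hU := IL_unif P
  have hLpos : 0 < Real.log 2 := Real.log_pos (by norm_num)
  have hlog2e : log2e = 1 / Real.log 2 := by
    unfold log2e Real.logb; rw [Real.log_exp]
  have hlog2e_pos : 0 < log2e := by rw [hlog2e]; positivity
  have hg3 : 0 ≤ g3 (ε + δ1 + δ2) := by unfold g3; positivity
  have hg2 : 0 ≤ g2 n n δ2 := by
    unfold g2
    have : 0 ≤ Real.logb 2 (2 * ((n : ℝ) + n) / (δ2 ^ 2 * log2e) + 1) := by
      apply Real.logb_nonneg (by norm_num)
      have : 0 ≤ 2 * ((n : ℝ) + n) / (δ2 ^ 2 * log2e) := by positivity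
      linarith
    linarith
  have hg1 : 10 ≤ g1 (2 * n) := by
    unfold g1
    have : 0 ≤ Real.logb 2 (2 * (n : ℝ) + 1) := by
      apply Real.logb_nonneg (by norm_num)
      have : (0 : ℝ) ≤ n := Nat.cast_nonneg n
      linarith
    linarith
  have har := arith (info (PA P)) (info (PB P)) (1 / 2 - ε) δ1 δ2
    (Real.sqrt (g3 (ε + δ1 + δ2))) (Real.sqrt n) n (Real.log 2)
    (info_nonneg _ (PA_nonneg P) (PA_sum P)) (info_nonneg _ (PB_nonneg P) (PB_sum P))
    hδ1 hδ2 (by linarith) (by linarith) (Real.sqrt_nonneg _) (Real.sqrt_nonneg _)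
    (Real.sq_sqrt (Nat.cast_nonneg n)) (by linarith [Real.log_two_gt_d9])
    (by linarith [Real.log_two_lt_d9])
    (by
      rw [Real.sq_sqrt hg3]
      unfold g3
      rw [hlog2e]
      field_simp
      ring)
    hcore
  rw [← hU] at har
  have har2 := le_of_mul_le_mul_right har hLpos
  have hprod : 0 ≤ δ1 * (g3 (ε + δ1 + δ2) + g2 n n δ2 + 10) := by positivity
  rw [ge_iff_le]
  linarith
end

section
/- For every shared-randomness SMP protocol Π, the worst-case (over input distributions) information complexity equals the worst-case information leakage: max_{μ ∈ D_{XY}} IC(Π,μ) = max_{μ ∈ D_{XY}} IL(Π,μ), i.e. IC(Π) = IL(Π). Consequently, for every function f : X × Y → Z and every ε ∈ [0,1/2), IC(f,ε) = IL(f,ε). -/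
open scoped BigOperators
open scoped Classical

noncomputable section

namespace FinDist

section
variable {Ω Ω' : Type} [Fintype Ω] [Fintype Ω']

lemma probEvent_prod (p : FinDist Ω) (q : FinDist Ω') (E : Ω → Prop) (F : Ω' → Prop) :
    probEvent (p.prod q) (fun ω => E ω.1 ∧ F ω.2) = probEvent p E * probEvent q F := by
  unfold probEvent
  rw [Fintype.sum_prod_type, Finset.sum_mul_sum]
  refine Finset.sum_congr rfl fun a _ => Finset.sum_congr rfl fun b _ => ?_
  by_cases h1 : E a <;> by_cases h2 : F b <;> simp [h1, h2, prod]

lemma probEvent_true (p : FinDist Ω) : probEvent p (fun _ => True) = 1 := by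
  simp [probEvent, p.sum_one]

lemma probEvent_eq (p : FinDist Ω) (a : Ω) : probEvent p (fun ω => ω = a) = p.prob a := by
  simp [probEvent]

lemma probVal_marginal {α β : Type*} [Fintype α] (p : FinDist Ω) (A : Ω → α) (B : Ω → β) (b : β) :
    probVal p B b = ∑ a, probVal p (fun ω => (A ω, B ω)) (a, b) := by
  unfold probVal probEvent
  rw [Finset.sum_comm]
  refine Finset.sum_congr rfl fun ω _ => ?_
  by_cases h : B ω = b <;> simp [h]

lemma probVal_nonneg {α : Type*} (p : FinDist Ω) (A : Ω → α) (a : α) : 0 ≤ probVal p A a := by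
  unfold probVal probEvent
  refine Finset.sum_nonneg fun ω _ => ?_
  split_ifs
  · exact p.nonneg ω
  · exact le_rfl

lemma le_probVal {α : Type*} (p : FinDist Ω) (A : Ω → α) (ω : Ω) :
    p.prob ω ≤ probVal p A (A ω) := by
  unfold probVal probEvent
  have h := Finset.single_le_sum (f := fun ω' => if A ω' = A ω then p.prob ω' else 0)
    (s := Finset.univ) (fun i _ => by
      show (0:ℝ) ≤ if A i = A ω then p.prob i else 0
      split_ifs
      · exact p.nonneg i
      · exact le_rfl) (Finset.mem_univ ω)
  simpa using h

/-- Sums over the image against the law are expectations. -/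
lemma sum_image_probVal {α : Type*} (p : FinDist Ω) (A : Ω → α) (F : α → ℝ) :
    ∑ a ∈ Finset.univ.image A, probVal p A a * F a = ∑ ω, p.prob ω * F (A ω) := by
  unfold probVal probEvent
  simp_rw [Finset.sum_mul]
  rw [Finset.sum_comm]
  refine Finset.sum_congr rfl fun ω _ => ?_
  rw [Finset.sum_eq_single (A ω)]
  · simp
  · intro b _ hb
    simp [hb.symm]
  · intro h
    exact absurd (Finset.mem_image_of_mem A (Finset.mem_univ ω)) h

lemma entropy_expect {α : Type*} (p : FinDist Ω) (A : Ω → α) :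
    entropy p A = ∑ ω, p.prob ω * -Real.logb 2 (probVal p A (A ω)) := by
  rw [← sum_image_probVal p A (fun a => -Real.logb 2 (probVal p A a))]
  unfold entropy
  exact Finset.sum_congr rfl fun a _ => by ring

lemma entropy_univ {α : Type*} [Fintype α] (p : FinDist Ω) (A : Ω → α) :
    entropy p A = ∑ a, -(probVal p A a * Real.logb 2 (probVal p A a)) := by
  unfold entropy
  refine Finset.sum_subset (Finset.subset_univ _) fun a _ ha => ?_
  have : probVal p A a = 0 := by
    unfold probVal probEvent
    refine Finset.sum_eq_zero fun ω _ => ?_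
    have : A ω ≠ a := fun h => ha (h ▸ Finset.mem_image_of_mem A (Finset.mem_univ ω))
    simp [this]
  simp [this]

lemma entropy_congr {α : Type*} [Fintype α] (p : FinDist Ω) (q : FinDist Ω') (A : Ω → α)
    (B : Ω' → α) (h : ∀ a, probVal p A a = probVal q B a) : entropy p A = entropy q B := by
  rw [entropy_univ, entropy_univ]
  simp_rw [h]

lemma sum_probVal {α : Type*} [Fintype α] (p : FinDist Ω) (A : Ω → α) :
    ∑ a, probVal p A a = 1 := by
  unfold probVal probEvent
  rw [Finset.sum_comm, ← p.sum_one]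
  exact Finset.sum_congr rfl fun ω _ => by simp

lemma entropy_pair_le {α β : Type*} [Fintype α] [Fintype β] (p : FinDist Ω)
    (A : Ω → α) (B : Ω → β) :
    entropy p (fun ω => (A ω, B ω)) ≤ entropy p A + entropy p B := by
  set J := probVal p (fun ω => (A ω, B ω)) with hJ
  have hlog2 : 0 < Real.log 2 := Real.log_pos (by norm_num)
  have key : ∀ ω, p.prob ω * -Real.logb 2 (J (A ω, B ω)) ≤
      p.prob ω * -Real.logb 2 (probVal p A (A ω)) + p.prob ω * -Real.logb 2 (probVal p B (B ω))
      + p.prob ω * ((probVal p A (A ω) * probVal p B (B ω) / J (A ω, B ω) - 1) / Real.log 2) := by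
    intro ω
    rcases (p.nonneg ω).eq_or_lt with h | h
    · simp [← h]
    have ha : 0 < probVal p A (A ω) := h.trans_le (le_probVal p A ω)
    have hb : 0 < probVal p B (B ω) := h.trans_le (le_probVal p B ω)
    have hj : 0 < J (A ω, B ω) := h.trans_le (le_probVal p (fun ω => (A ω, B ω)) ω)
    rw [← mul_add, ← mul_add]
    refine mul_le_mul_of_nonneg_left ?_ h.le
    have := Real.log_le_sub_one_of_pos (div_pos (mul_pos ha hb) hj)
    rw [Real.log_div (by positivity) (by positivity), Real.log_mul (by positivity) (by positivity)]
      at this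
    have h2 := div_le_div_of_nonneg_right this hlog2.le
    simp only [Real.logb]
    have h3 : (Real.log (probVal p A (A ω)) + Real.log (probVal p B (B ω))
      - Real.log (J (A ω, B ω))) / Real.log 2 = Real.log (probVal p A (A ω)) / Real.log 2
      + Real.log (probVal p B (B ω)) / Real.log 2 - Real.log (J (A ω, B ω)) / Real.log 2 := by ring
    linarith
  have hsum : ∑ ω, p.prob ω * -Real.logb 2 (J (A ω, B ω)) ≤
      ∑ ω, (p.prob ω * -Real.logb 2 (probVal p A (A ω))
      + p.prob ω * -Real.logb 2 (probVal p B (B ω))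
      + p.prob ω * ((probVal p A (A ω) * probVal p B (B ω) / J (A ω, B ω) - 1) / Real.log 2)) :=
    Finset.sum_le_sum fun ω _ => key ω
  rw [Finset.sum_add_distrib, Finset.sum_add_distrib, ← entropy_expect p A,
    ← entropy_expect p B, ← entropy_expect p (fun ω => (A ω, B ω))] at hsum
  have hle : ∑ ω, p.prob ω * ((probVal p A (A ω) * probVal p B (B ω) / J (A ω, B ω) - 1)
      / Real.log 2) ≤ 0 := by
    have e1 : ∑ ω, p.prob ω * (probVal p A (A ω) * probVal p B (B ω) / J (A ω, B ω)) ≤ 1 := by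
      rw [← sum_image_probVal p (fun ω => (A ω, B ω))
        (fun c => probVal p A c.1 * probVal p B c.2 / J c)]
      refine le_trans (Finset.sum_le_sum (g := fun c => probVal p A c.1 * probVal p B c.2) ?_)
        (le_trans (Finset.sum_le_sum_of_subset_of_nonneg (Finset.subset_univ _) fun c _ _ =>
              mul_nonneg (probVal_nonneg _ _ _) (probVal_nonneg _ _ _)) ?_)
      · intro c _
        rw [← hJ]
        have hn : 0 ≤ probVal p A c.1 * probVal p B c.2 :=
          mul_nonneg (probVal_nonneg _ _ _) (probVal_nonneg _ _ _)
        by_cases h0 : J c = 0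
        · simpa [h0] using hn
        · rw [mul_div_cancel₀ _ h0]
      · rw [Fintype.sum_prod_type, ← Finset.sum_mul_sum, sum_probVal, sum_probVal, one_mul]
    have e2 : ∑ ω, p.prob ω * ((probVal p A (A ω) * probVal p B (B ω) / J (A ω, B ω) - 1)
      / Real.log 2) = (∑ ω, p.prob ω * (probVal p A (A ω) * probVal p B (B ω) / J (A ω, B ω))
        - ∑ ω, p.prob ω) / Real.log 2 := by
      rw [← Finset.sum_sub_distrib, Finset.sum_div]
      exact Finset.sum_congr rfl fun ω _ => by ring
    rw [e2, p.sum_one]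
    exact div_nonpos_of_nonpos_of_nonneg (by linarith) hlog2.le
  linarith

lemma entropy_pair_eq {α β : Type*} (p : FinDist Ω) (A : Ω → α) (B : Ω → β)
    (h : ∀ a b, probVal p (fun ω => (A ω, B ω)) (a, b) = probVal p A a * probVal p B b) :
    entropy p (fun ω => (A ω, B ω)) = entropy p A + entropy p B := by
  rw [entropy_expect, entropy_expect, entropy_expect, ← Finset.sum_add_distrib]
  refine Finset.sum_congr rfl fun ω _ => ?_
  rcases (p.nonneg ω).eq_or_lt with h0 | h0
  · simp [← h0]
  have ha : 0 < probVal p A (A ω) := h0.trans_le (le_probVal p A ω)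
  have hb : 0 < probVal p B (B ω) := h0.trans_le (le_probVal p B ω)
  rw [h, Real.logb_mul ha.ne' hb.ne']
  ring

end

end FinDist

namespace ShSMP

open FinDist

section
variable {X Y Z : Type} [Fintype X] [Fintype Y] [Fintype Z]

def mX (μ : FinDist (X × Y)) (x : X) : ℝ := ∑ y, μ.prob (x, y)
def mY (μ : FinDist (X × Y)) (y : Y) : ℝ := ∑ x, μ.prob (x, y)

lemma probEvent_fst (μ : FinDist (X × Y)) (x : X) :
    probEvent μ (fun xy => xy.1 = x) = mX μ x := by
  unfold probEvent mX
  rw [Fintype.sum_prod_type, Finset.sum_comm]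
  simp

lemma probEvent_snd (μ : FinDist (X × Y)) (y : Y) :
    probEvent μ (fun xy => xy.2 = y) = mY μ y := by
  unfold probEvent mY
  rw [Fintype.sum_prod_type]
  simp

def kA (P : ShSMP X Y Z) (x : X) (m : P.MA) (s : P.RAC) : ℝ :=
  probEvent P.dRA (fun r => P.pA x r s = m)
def kB (P : ShSMP X Y Z) (y : Y) (m : P.MB) (t : P.RBC) : ℝ :=
  probEvent P.dRB (fun r => P.pB y r t = m)

/-- The probability of a product event. -/
lemma prob_box (P : ShSMP X Y Z) (μ : FinDist (X × Y)) (E : X × Y → Prop) (EA : P.RA → Prop)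
    (EB : P.RB → Prop) (EC : P.RC → Prop) (ES : P.RAC → Prop) (ET : P.RBC → Prop)
    (F : (X × Y) × (P.RA × P.RB × P.RC × P.RAC × P.RBC) → Prop)
    (hF : ∀ xy a b c s t, F (xy, a, b, c, s, t) ↔ (E xy ∧ EA a ∧ EB b ∧ EC c ∧ ES s ∧ ET t)) :
    probEvent (P.space μ) F = probEvent μ E * (probEvent P.dRA EA * (probEvent P.dRB EB *
      (probEvent P.dRC EC * (probEvent P.dRAC ES * probEvent P.dRBC ET)))) := by
  have : F = fun ω => E ω.1 ∧ (fun r : P.RA × P.RB × P.RC × P.RAC × P.RBC =>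
    EA r.1 ∧ (fun r : P.RB × P.RC × P.RAC × P.RBC =>
    EB r.1 ∧ (fun r : P.RC × P.RAC × P.RBC =>
    EC r.1 ∧ (fun r : P.RAC × P.RBC => ES r.1 ∧ ET r.2) r.2) r.2) r.2) ω.2 := by
    funext ⟨xy, a, b, c, s, t⟩
    exact propext (hF xy a b c s t)
  rw [this, ← probEvent_prod P.dRAC, ← probEvent_prod P.dRC, ← probEvent_prod P.dRB,
    ← probEvent_prod P.dRA, ← probEvent_prod μ]
  rfl

variable (P : ShSMP X Y Z) (μ : FinDist (X × Y))

lemma pv_XY (xy : X × Y) : probVal (P.space μ) (fun ω => ω.1) xy = μ.prob xy := by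
  unfold probVal
  rw [prob_box P μ (fun w => w = xy) (fun _ => True) (fun _ => True) (fun _ => True)
    (fun _ => True) (fun _ => True) _ (by intros; simp)]
  simp [probEvent_true, probEvent_eq]

lemma pv_RAC (s : P.RAC) : probVal (P.space μ) (fun ω => P.rvRAC ω) s = P.dRAC.prob s := by
  unfold probVal
  rw [prob_box P μ (fun _ => True) (fun _ => True) (fun _ => True) (fun _ => True)
    (fun w => w = s) (fun _ => True) _ (by intros; simp [rvRAC])]
  simp [probEvent_true, probEvent_eq]

lemma pv_RBC (t : P.RBC) : probVal (P.space μ) (fun ω => P.rvRBC ω) t = P.dRBC.prob t := by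
  unfold probVal
  rw [prob_box P μ (fun _ => True) (fun _ => True) (fun _ => True) (fun _ => True)
    (fun _ => True) (fun w => w = t) _ (by intros; simp [rvRBC])]
  simp [probEvent_true, probEvent_eq]

lemma pv_XRAC (x : X) (s : P.RAC) : probVal (P.space μ) (fun ω => (ω.1.1, P.rvRAC ω)) (x, s)
    = mX μ x * P.dRAC.prob s := by
  unfold probVal
  rw [prob_box P μ (fun w => w.1 = x) (fun _ => True) (fun _ => True) (fun _ => True)
    (fun w => w = s) (fun _ => True) _ (by intros; simp [rvRAC])]
  simp [probEvent_true, probEvent_eq, probEvent_fst]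

lemma pv_YRBC (y : Y) (t : P.RBC) : probVal (P.space μ) (fun ω => (ω.1.2, P.rvRBC ω)) (y, t)
    = mY μ y * P.dRBC.prob t := by
  unfold probVal
  rw [prob_box P μ (fun w => w.2 = y) (fun _ => True) (fun _ => True) (fun _ => True)
    (fun _ => True) (fun w => w = t) _ (by intros; simp [rvRBC])]
  simp [probEvent_true, probEvent_eq, probEvent_snd]

lemma pv_XMA (x : X) (m : P.MA) (s : P.RAC) :
    probVal (P.space μ) (fun ω => (ω.1.1, P.rvMA ω, P.rvRAC ω)) (x, m, s)
    = mX μ x * (P.kA x m s * P.dRAC.prob s) := by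
  unfold probVal
  rw [prob_box P μ (fun w => w.1 = x) (fun r => P.pA x r s = m) (fun _ => True) (fun _ => True)
    (fun w => w = s) (fun _ => True) _ (by
      intros; simp only [rvRAC, rvMA, Prod.mk.injEq, true_and, and_true]
      constructor <;> (rintro ⟨rfl, h, rfl⟩; exact ⟨rfl, h, rfl⟩))]
  simp [probEvent_true, probEvent_eq, probEvent_fst, kA]

lemma pv_YMB (y : Y) (m : P.MB) (t : P.RBC) :
    probVal (P.space μ) (fun ω => (ω.1.2, P.rvMB ω, P.rvRBC ω)) (y, m, t)
    = mY μ y * (P.kB y m t * P.dRBC.prob t) := by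
  unfold probVal
  rw [prob_box P μ (fun w => w.2 = y) (fun _ => True) (fun r => P.pB y r t = m) (fun _ => True)
    (fun _ => True) (fun w => w = t) _ (by
      intros; simp only [rvRBC, rvMB, Prod.mk.injEq, true_and]
      constructor <;> (rintro ⟨rfl, h, rfl⟩; exact ⟨rfl, h, rfl⟩))]
  simp [probEvent_true, probEvent_eq, probEvent_snd, kB]

lemma pv_MA (m : P.MA) (s : P.RAC) :
    probVal (P.space μ) (fun ω => (P.rvMA ω, P.rvRAC ω)) (m, s)
    = ∑ x, mX μ x * (P.kA x m s * P.dRAC.prob s) := by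
  rw [probVal_marginal _ (fun ω => ω.1.1)]
  exact Finset.sum_congr rfl fun x _ => pv_XMA P μ x m s

lemma pv_MB (m : P.MB) (t : P.RBC) :
    probVal (P.space μ) (fun ω => (P.rvMB ω, P.rvRBC ω)) (m, t)
    = ∑ y, mY μ y * (P.kB y m t * P.dRBC.prob t) := by
  rw [probVal_marginal _ (fun ω => ω.1.2)]
  exact Finset.sum_congr rfl fun x _ => pv_YMB P μ x m t

lemma pv_XYO (xy : X × Y) (m : P.MA) (n : P.MB) (c : P.RC) (s : P.RAC) (t : P.RBC) :
    probVal (P.space μ) (fun ω => (ω.1, P.rvMA ω, P.rvMB ω, P.rvRC ω, P.rvRAC ω, P.rvRBC ω))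
      (xy, m, n, c, s, t)
    = μ.prob xy * ((P.kA xy.1 m s * P.dRAC.prob s) * (P.kB xy.2 n t * P.dRBC.prob t))
      * P.dRC.prob c := by
  unfold probVal
  rw [prob_box P μ (fun w => w = xy) (fun r => P.pA xy.1 r s = m) (fun r => P.pB xy.2 r t = n)
    (fun w => w = c) (fun w => w = s) (fun w => w = t) _ (by
      intros; simp only [rvRBC, rvMB, rvRAC, rvMA, rvRC, Prod.mk.injEq]
      constructor <;> (rintro ⟨rfl, h, h', rfl, rfl, rfl⟩; exact ⟨rfl, h, h', rfl, rfl, rfl⟩))]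
  simp only [probEvent_eq, kA, kB]
  ring

lemma pv_XYAB (xy : X × Y) (m : P.MA) (n : P.MB) (s : P.RAC) (t : P.RBC) :
    probVal (P.space μ) (fun ω => (ω.1, (P.rvMA ω, P.rvRAC ω), (P.rvMB ω, P.rvRBC ω)))
      (xy, (m, s), (n, t))
    = μ.prob xy * ((P.kA xy.1 m s * P.dRAC.prob s) * (P.kB xy.2 n t * P.dRBC.prob t)) := by
  unfold probVal
  rw [prob_box P μ (fun w => w = xy) (fun r => P.pA xy.1 r s = m) (fun r => P.pB xy.2 r t = n)
    (fun _ => True) (fun w => w = s) (fun w => w = t) _ (by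
      intros; simp only [rvRBC, rvMB, rvRAC, rvMA, Prod.mk.injEq, true_and]
      constructor
      · rintro ⟨rfl, ⟨h, rfl⟩, h', rfl⟩; exact ⟨rfl, h, h', rfl, rfl⟩
      · rintro ⟨rfl, h, h', rfl, rfl⟩; exact ⟨rfl, ⟨h, rfl⟩, h', rfl⟩)]
  simp only [probEvent_eq, probEvent_true, kA, kB]
  ring

lemma pv_AB (m : P.MA) (n : P.MB) (s : P.RAC) (t : P.RBC) :
    probVal (P.space μ) (fun ω => ((P.rvMA ω, P.rvRAC ω), (P.rvMB ω, P.rvRBC ω)))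
      ((m, s), (n, t))
    = ∑ xy, μ.prob xy * ((P.kA xy.1 m s * P.dRAC.prob s) * (P.kB xy.2 n t * P.dRBC.prob t)) := by
  rw [probVal_marginal _ (fun ω => ω.1)]
  exact Finset.sum_congr rfl fun x _ => pv_XYAB P μ x m n s t

lemma pv_O (m : P.MA) (n : P.MB) (c : P.RC) (s : P.RAC) (t : P.RBC) :
    probVal (P.space μ) (fun ω => (P.rvMA ω, P.rvMB ω, P.rvRC ω, P.rvRAC ω, P.rvRBC ω))
      (m, n, c, s, t)
    = probVal (P.space μ) (fun ω => ((P.rvMA ω, P.rvRAC ω), (P.rvMB ω, P.rvRBC ω)))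
      ((m, s), (n, t)) * P.dRC.prob c := by
  rw [pv_AB, probVal_marginal _ (fun ω => ω.1), Finset.sum_mul]
  exact Finset.sum_congr rfl fun x _ => pv_XYO P μ x m n c s t

/-- The key entropy identity. -/
lemma IC_sub_IL : P.IC μ - P.IL μ =
    entropy (P.space μ) (fun ω => (P.rvMA ω, P.rvRAC ω))
    + entropy (P.space μ) (fun ω => (P.rvMB ω, P.rvRBC ω))
    - entropy (P.space μ) (fun ω => ((P.rvMA ω, P.rvRAC ω), (P.rvMB ω, P.rvRBC ω))) := by
  have key : entropy (P.space μ) (fun ω => (ω.1.1, P.rvRAC ω))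
      + entropy (P.space μ) (fun ω => (ω.1.2, P.rvRBC ω))
      + entropy (P.space μ) (fun ω => (ω.1, P.rvMA ω, P.rvMB ω, P.rvRC ω, P.rvRAC ω, P.rvRBC ω))
      + entropy (P.space μ) (fun ω => ((P.rvMA ω, P.rvRAC ω), (P.rvMB ω, P.rvRBC ω)))
      = entropy (P.space μ) (fun ω => P.rvRAC ω) + entropy (P.space μ) (fun ω => P.rvRBC ω)
      + entropy (P.space μ) (fun ω => (ω.1.1, P.rvMA ω, P.rvRAC ω))
      + entropy (P.space μ) (fun ω => (ω.1.2, P.rvMB ω, P.rvRBC ω))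
      + entropy (P.space μ) (fun ω => ω.1)
      + entropy (P.space μ) (fun ω => (P.rvMA ω, P.rvMB ω, P.rvRC ω, P.rvRAC ω, P.rvRBC ω)) := by
    simp only [entropy_expect, ← Finset.sum_add_distrib]
    refine Finset.sum_congr rfl fun ω _ => ?_
    rcases ((P.space μ).nonneg ω).eq_or_lt with h0 | h0
    · simp [← h0]
    have h1 := h0.trans_le (le_probVal (P.space μ)
      (fun ω => (ω.1, P.rvMA ω, P.rvMB ω, P.rvRC ω, P.rvRAC ω, P.rvRBC ω)) ω)
    have h2 := h0.trans_le (le_probVal (P.space μ)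
      (fun ω => ((P.rvMA ω, P.rvRAC ω), (P.rvMB ω, P.rvRBC ω))) ω)
    have h3 := h0.trans_le (le_probVal (P.space μ) (fun ω => (ω.1.1, P.rvRAC ω)) ω)
    have h4 := h0.trans_le (le_probVal (P.space μ) (fun ω => (ω.1.2, P.rvRBC ω)) ω)
    simp only [pv_XYO, pv_XRAC, pv_YRBC] at h1 h3 h4
    simp only [pv_XYO, pv_XRAC, pv_YRBC, pv_RAC, pv_RBC, pv_XMA, pv_YMB, pv_XY, pv_O]
    have n1 := h1.ne'
    have n2 := h2.ne'
    have n3 := h3.ne'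
    have n4 := h4.ne'
    simp only [mul_ne_zero_iff] at n1 n3 n4
    obtain ⟨⟨a1, ⟨a2, a3⟩, a4, a5⟩, a6⟩ := n1
    obtain ⟨a7, _⟩ := n3
    obtain ⟨a8, _⟩ := n4
    generalize probVal (P.space μ) (fun ω => ((P.rvMA ω, P.rvRAC ω), (P.rvMB ω, P.rvRBC ω)))
      ((P.rvMA ω, P.rvRAC ω), (P.rvMB ω, P.rvRBC ω)) = Q at *
    rw [Real.logb_mul (mul_ne_zero a1 (mul_ne_zero (mul_ne_zero a2 a3) (mul_ne_zero a4 a5))) a6,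
      Real.logb_mul a1 (mul_ne_zero (mul_ne_zero a2 a3) (mul_ne_zero a4 a5)),
      Real.logb_mul (mul_ne_zero a2 a3) (mul_ne_zero a4 a5),
      Real.logb_mul a7 (mul_ne_zero a2 a3), Real.logb_mul a8 (mul_ne_zero a4 a5),
      Real.logb_mul a7 a3, Real.logb_mul a8 a5, Real.logb_mul n2 a6]
    ring
  unfold IC IL condMutualInfo mutualInfo
  linarith

lemma IL_le_IC : P.IL μ ≤ P.IC μ := by
  have h1 := IC_sub_IL P μ
  have h2 := entropy_pair_le (P.space μ) (fun ω => (P.rvMA ω, P.rvRAC ω))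
    (fun ω => (P.rvMB ω, P.rvRBC ω))
  linarith

/-- Product of the marginals. -/
def indepDist : FinDist (X × Y) where
  prob := fun xy => mX μ xy.1 * mY μ xy.2
  nonneg := fun xy => mul_nonneg (Finset.sum_nonneg fun _ _ => μ.nonneg _)
    (Finset.sum_nonneg fun _ _ => μ.nonneg _)
  sum_one := by
    have hx : ∑ x, mX μ x = 1 := by
      unfold mX; rw [← Fintype.sum_prod_type]; exact μ.sum_one
    have hy : ∑ y, mY μ y = 1 := by
      unfold mY; rw [← Fintype.sum_prod_type_right]; exact μ.sum_one
    rw [Fintype.sum_prod_type]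
    simp only
    rw [← Finset.sum_mul_sum, hx, hy, one_mul]

lemma mX_indep (x : X) : mX (indepDist μ) x = mX μ x := by
  have hy : ∑ y, mY μ y = 1 := by
    unfold mY; rw [← Fintype.sum_prod_type_right]; exact μ.sum_one
  show ∑ y, mX μ x * mY μ y = _
  rw [← Finset.mul_sum, hy, mul_one]

lemma mY_indep (y : Y) : mY (indepDist μ) y = mY μ y := by
  have hx : ∑ x, mX μ x = 1 := by
    unfold mX; rw [← Fintype.sum_prod_type]; exact μ.sum_one
  show ∑ x, mX μ x * mY μ y = _
  rw [← Finset.sum_mul, hx, one_mul]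

lemma IC_indep : P.IC (indepDist μ) = P.IC μ := by
  unfold IC condMutualInfo
  rw [entropy_congr (P.space (indepDist μ)) (P.space μ) (fun ω => (ω.1.1, P.rvRAC ω))
      (fun ω => (ω.1.1, P.rvRAC ω)) (by rintro ⟨x, s⟩; rw [pv_XRAC, pv_XRAC, mX_indep]),
    entropy_congr (P.space (indepDist μ)) (P.space μ) (fun ω => (ω.1.2, P.rvRBC ω))
      (fun ω => (ω.1.2, P.rvRBC ω)) (by rintro ⟨x, s⟩; rw [pv_YRBC, pv_YRBC, mY_indep]),
    entropy_congr (P.space (indepDist μ)) (P.space μ) (fun ω => (P.rvMA ω, P.rvRAC ω))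
      (fun ω => (P.rvMA ω, P.rvRAC ω)) (by rintro ⟨x, s⟩; simp only [pv_MA, mX_indep]),
    entropy_congr (P.space (indepDist μ)) (P.space μ) (fun ω => (P.rvMB ω, P.rvRBC ω))
      (fun ω => (P.rvMB ω, P.rvRBC ω)) (by rintro ⟨x, s⟩; simp only [pv_MB, mY_indep]),
    entropy_congr (P.space (indepDist μ)) (P.space μ) (fun ω => (ω.1.1, P.rvMA ω, P.rvRAC ω))
      (fun ω => (ω.1.1, P.rvMA ω, P.rvRAC ω))
      (by rintro ⟨x, m, s⟩; rw [pv_XMA, pv_XMA, mX_indep]),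
    entropy_congr (P.space (indepDist μ)) (P.space μ) (fun ω => (ω.1.2, P.rvMB ω, P.rvRBC ω))
      (fun ω => (ω.1.2, P.rvMB ω, P.rvRBC ω))
      (by rintro ⟨x, m, s⟩; rw [pv_YMB, pv_YMB, mY_indep]),
    entropy_congr (P.space (indepDist μ)) (P.space μ) (fun ω => P.rvRAC ω)
      (fun ω => P.rvRAC ω) (by intro s; rw [pv_RAC, pv_RAC]),
    entropy_congr (P.space (indepDist μ)) (P.space μ) (fun ω => P.rvRBC ω)
      (fun ω => P.rvRBC ω) (by intro s; rw [pv_RBC, pv_RBC])]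

lemma IL_indep : P.IL (indepDist μ) = P.IC μ := by
  rw [← IC_indep]
  have h1 := IC_sub_IL P (indepDist μ)
  have h2 := entropy_pair_eq (P.space (indepDist μ)) (fun ω => (P.rvMA ω, P.rvRAC ω))
    (fun ω => (P.rvMB ω, P.rvRBC ω)) (by
      rintro ⟨m, s⟩ ⟨n, t⟩
      rw [pv_AB, pv_MA, pv_MB, Finset.sum_mul_sum, Fintype.sum_prod_type]
      refine Finset.sum_congr rfl fun x _ => Finset.sum_congr rfl fun y _ => ?_
      rw [mX_indep, mY_indep]
      simp only [indepDist]
      ring)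
  linarith

lemma ICmax_eq_ILmax : P.ICmax = P.ILmax := by
  unfold ICmax ILmax
  rcases isEmpty_or_nonempty (FinDist (X × Y)) with h | h
  · rw [Real.iSup_of_isEmpty, Real.iSup_of_isEmpty]
  by_cases hb : BddAbove (Set.range fun μ : FinDist (X × Y) => P.IC μ)
  · have hb' : BddAbove (Set.range fun μ : FinDist (X × Y) => P.IL μ) := by
      obtain ⟨C, hC⟩ := hb
      refine ⟨C, ?_⟩
      rintro _ ⟨μ, rfl⟩
      exact (IL_le_IC P μ).trans (hC ⟨μ, rfl⟩)
    apply le_antisymm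
    · exact ciSup_le fun μ => (IL_indep P μ).symm.le.trans (le_ciSup hb' (indepDist μ))
    · exact ciSup_le fun μ => (IL_le_IC P μ).trans (le_ciSup hb μ)
  · have hb' : ¬ BddAbove (Set.range fun μ : FinDist (X × Y) => P.IL μ) := by
      rintro ⟨C, hC⟩
      refine hb ⟨C, ?_⟩
      rintro _ ⟨μ, rfl⟩
      exact (IL_indep P μ).symm.le.trans (hC ⟨indepDist μ, rfl⟩)
    rw [Real.iSup_of_not_bddAbove hb, Real.iSup_of_not_bddAbove hb']

end

end ShSMP

end

/-- For worst-case input distributions, information complexity and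
information leakage agree, both per protocol and per function. -/
theorem ic_eq_il_worst_case (X Y Z : Type) [Fintype X] [Fintype Y] [Fintype Z] :
    (∀ P : ShSMP X Y Z, P.ICmax = P.ILmax) ∧
    (∀ (f : X → Y → Z) (ε : ℝ), 0 ≤ ε → ε < 1 / 2 → ICf f ε = ILf f ε) := by
  refine ⟨fun P => P.ICmax_eq_ILmax, fun f ε _ _ => ?_⟩
  unfold ICf ILf
  simp only [ShSMP.ICmax_eq_ILmax]
end

section
/- Let f : X × Y → {0,1} be a Boolean function on finite nonempty sets X, Y, let ε ≥ 0, δ₁ > 0, δ₂ > 0 satisfy ε + δ₁ + δ₂ < 1/2, and set n_A = log₂|X|, n_B = log₂|Y|. Then every shared-randomness SMP protocol Π computing f with worst-case error at most ε satisfies IL(Π) ≥ δ₁·(CC_priv(f, ε+δ₁+δ₂) − g₂(n_A, n_B, δ₂) − 4) − 2·g₁(CC_priv(f, ε)), i.e. IL(f,ε) ≥ δ₁·(CC_priv(f, ε+δ₁+δ₂) − g₂(n_A, n_B, δ₂) − 4) − 2·g₁(CC_priv(f, ε)), where g₁(x) = 2·log₂(x+1) + 10 and g₂(x,y,z) = 2·log₂(2(x+y)/(z²·log₂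 e) + 1) + 2. -/
open scoped BigOperators
open scoped Classical

lemma hoeffding_fin {S : Type} [Fintype S] (d : FinDist S) (g : S → ℝ)
    (h0 : ∀ s, 0 ≤ g s) (h1 : ∀ s, g s ≤ 1) (l : ℝ) :
    ∑ s, d.prob s * Real.exp (l * (g s - ∑ s, d.prob s * g s)) ≤ Real.exp (l ^ 2 / 8) := by
  let _ : MeasurableSpace S := ⊤
  let p : PMF S := PMF.ofFintype (fun s => ENNReal.ofReal (d.prob s)) (by
    rw [← ENNReal.ofReal_sum_of_nonneg (fun s _ => d.nonneg s), d.sum_one, ENNReal.ofReal_one])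
  have hp : ∀ s, (p s).toReal = d.prob s := fun s => by
    simp [p, PMF.ofFintype_apply, ENNReal.toReal_ofReal (d.nonneg s)]
  have hint : ∀ F : S → ℝ, ∫ s, F s ∂p.toMeasure = ∑ s, d.prob s * F s := by
    intro F
    rw [PMF.integral_eq_sum]
    simp [hp]
  have h := ProbabilityTheory.hasSubgaussianMGF_of_mem_Icc (μ := p.toMeasure) (X := g)
    (a := 0) (b := 1) (measurable_from_top.aemeasurable) (Filter.Eventually.of_forall fun s => ⟨h0 s, h1 s⟩)
  have := h.mgf_le l
  rw [ProbabilityTheory.mgf, hint, hint] at this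
  refine this.trans (le_of_eq ?_)
  congr 1
  simp
  ring

/-- product distribution -/
def FinDist.pi {I M : Type} [Fintype I] [DecidableEq I] [Fintype M] (a : I → FinDist M) : FinDist (I → M) where
  prob r := ∏ i, (a i).prob (r i)
  nonneg r := Finset.prod_nonneg fun i _ => (a i).nonneg _
  sum_one := by
    have := (Finset.prod_univ_sum (fun _ : I => (Finset.univ : Finset M)) (fun i m => (a i).prob m)).symm
    simp only [Fintype.piFinset_univ] at this
    rw [this]
    simp [FinDist.sum_one]

lemma sum_pi_prod {I M : Type} [Fintype I] [DecidableEq I] [Fintype M] (F : I → M → ℝ) :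
    ∑ r : I → M, ∏ i, F i (r i) = ∏ i, ∑ m, F i m := by
  have := (Finset.prod_univ_sum (fun _ : I => (Finset.univ : Finset M)) F).symm
  simpa only [Fintype.piFinset_univ] using this

lemma sum_pi_marginal {I M : Type} [Fintype I] [DecidableEq I] [Fintype M] (a : I → FinDist M) (i0 : I) (F : M → ℝ) :
    ∑ r, (FinDist.pi a).prob r * F (r i0) = ∑ m, (a i0).prob m * F m := by
  have h := sum_pi_prod (fun i m => (a i).prob m * if i = i0 then F m else 1)
  have e1 : ∀ r : I → M, ∏ i, ((a i).prob (r i) * if i = i0 then F (r i) else 1)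
      = (FinDist.pi a).prob r * F (r i0) := by
    intro r
    rw [Finset.prod_mul_distrib]
    simp [FinDist.pi]
  simp only [e1] at h
  rw [h, ← Finset.mul_prod_erase _ _ (Finset.mem_univ i0)]
  simp only [if_true]
  rw [Finset.prod_eq_one, mul_one]
  intro i hi
  simp [Finset.ne_of_mem_erase hi, FinDist.sum_one]

lemma newman_one {I S : Type} [Fintype I] [Fintype S] (d : FinDist S) (g : I → S → ℝ)
    (h0 : ∀ i s, 0 ≤ g i s) (h1 : ∀ i s, g i s ≤ 1) (T : ℕ) (hT : 0 < T) (δ : ℝ) (hδ : 0 < δ)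
    (hI : (Fintype.card I : ℝ) < Real.exp (2 * T * δ ^ 2)) :
    ∃ s : Fin T → S, ∀ i, (1 / (T : ℝ)) * ∑ j, g i (s j) ≤ (∑ s, d.prob s * g i s) + δ := by
  by_contra hcon
  push Not at hcon
  set E : I → ℝ := fun i => ∑ s, d.prob s * g i s with hE
  have hT' : (0 : ℝ) < T := by exact_mod_cast hT
  have key : ∀ i, ∑ s : Fin T → S, (FinDist.pi (fun _ => d)).prob s *
      Real.exp (4 * δ * ∑ j, (g i (s j) - E i)) ≤ Real.exp (2 * T * δ ^ 2) := by
    intro i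
    have h := sum_pi_prod (I := Fin T) (fun _ m => d.prob m * Real.exp (4 * δ * (g i m - E i)))
    have e1 : ∀ s : Fin T → S, (FinDist.pi (fun _ => d)).prob s *
      Real.exp (4 * δ * ∑ j, (g i (s j) - E i)) = ∏ j, (d.prob (s j) * Real.exp (4 * δ * (g i (s j) - E i))) := by
      intro s
      rw [Finset.prod_mul_distrib, ← Real.exp_sum, Finset.mul_sum]
      rfl
    simp only [e1]
    rw [h, Finset.prod_const, Finset.card_univ, Fintype.card_fin]
    calc _ ≤ (Real.exp ((4 * δ) ^ 2 / 8)) ^ T := by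
          apply pow_le_pow_left₀
          · exact Finset.sum_nonneg fun s _ => mul_nonneg (d.nonneg _) (Real.exp_pos _).le
          · exact hoeffding_fin d (g i) (h0 i) (h1 i) (4 * δ)
      _ = _ := by
          rw [← Real.exp_nat_mul]; congr 1; ring
  have low : ∀ s : Fin T → S, Real.exp (4 * T * δ ^ 2) ≤
      ∑ i, Real.exp (4 * δ * ∑ j, (g i (s j) - E i)) := by
    intro s
    obtain ⟨i, hi⟩ := hcon s
    refine le_trans ?_ (Finset.single_le_sum (f := fun i => Real.exp (4 * δ * ∑ j, (g i (s j) - E i)))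
      (fun i _ => (Real.exp_pos _).le) (Finset.mem_univ i))
    apply Real.exp_le_exp.2
    have : T * δ ≤ ∑ j, (g i (s j) - E i) := by
      rw [Finset.sum_sub_distrib]
      simp only [Finset.sum_const, Finset.card_univ, Fintype.card_fin, nsmul_eq_mul]
      have h2 := mul_lt_mul_of_pos_left hi hT'
      rw [← mul_assoc, mul_one_div_cancel hT'.ne', one_mul] at h2
      change T * (E i + δ) < _ at h2
      linarith
    nlinarith
  have tot : Real.exp (4 * T * δ ^ 2) ≤ Fintype.card I * Real.exp (2 * T * δ ^ 2) := by
    calc _ = ∑ s : Fin T → S, (FinDist.pi (fun _ => d)).prob s * Real.exp (4 * T * δ ^ 2) := by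
            rw [← Finset.sum_mul, FinDist.sum_one, one_mul]
      _ ≤ ∑ s : Fin T → S, (FinDist.pi (fun _ => d)).prob s * ∑ i, Real.exp (4 * δ * ∑ j, (g i (s j) - E i)) :=
            Finset.sum_le_sum fun s _ => mul_le_mul_of_nonneg_left (low s) (FinDist.nonneg _ _)
      _ = ∑ i, ∑ s : Fin T → S, (FinDist.pi (fun _ => d)).prob s * Real.exp (4 * δ * ∑ j, (g i (s j) - E i)) := by
            simp only [Finset.mul_sum]
            rw [Finset.sum_comm]
      _ ≤ ∑ i : I, Real.exp (2 * T * δ ^ 2) := Finset.sum_le_sum fun i _ => key i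
      _ = _ := by simp
  have : Real.exp (4 * T * δ ^ 2) = Real.exp (2 * T * δ ^ 2) * Real.exp (2 * T * δ ^ 2) := by
    rw [← Real.exp_add]; congr 1; ring
  have hp := Real.exp_pos (2 * T * δ ^ 2)
  nlinarith

lemma newman_two {I S S' : Type} [Fintype I] [Fintype S] [Fintype S'] (d : FinDist S) (d' : FinDist S')
    (e : I → S → S' → ℝ)
    (h0 : ∀ i s s', 0 ≤ e i s s') (h1 : ∀ i s s', e i s s' ≤ 1) (T : ℕ) (hT : 0 < T) (δ η : ℝ) (hδ : 0 < δ)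
    (hI : (Fintype.card I : ℝ) < Real.exp (2 * T * (δ / 2) ^ 2))
    (he : ∀ i, ∑ s, d.prob s * ∑ s', d'.prob s' * e i s s' ≤ η) :
    ∃ (s : Fin T → S) (s' : Fin T → S'), ∀ i,
      (1 / (T : ℝ)) * ∑ j, (1 / (T : ℝ)) * ∑ k, e i (s j) (s' k) ≤ η + δ := by
  have hT' : (0 : ℝ) < T := by exact_mod_cast hT
  obtain ⟨s, hs⟩ := newman_one d (fun i s => ∑ s', d'.prob s' * e i s s')
    (fun i s => Finset.sum_nonneg fun s' _ => mul_nonneg (d'.nonneg _) (h0 _ _ _))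
    (fun i s => by
      calc _ ≤ ∑ s', d'.prob s' * 1 :=
            Finset.sum_le_sum fun s' _ => mul_le_mul_of_nonneg_left (h1 _ _ _) (d'.nonneg _)
        _ = 1 := by simp [d'.sum_one]) T hT (δ / 2) (by linarith) hI
  obtain ⟨s', hs'⟩ := newman_one d' (fun i s' => (1 / (T : ℝ)) * ∑ j, e i (s j) s')
    (fun i s' => mul_nonneg (by positivity) (Finset.sum_nonneg fun j _ => h0 _ _ _))
    (fun i s' => by
      calc _ ≤ (1 / (T : ℝ)) * ∑ j : Fin T, 1 :=
            mul_le_mul_of_nonneg_left (Finset.sum_le_sum fun j _ => h1 _ _ _) (by positivity)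
        _ = 1 := by simp [hT'.ne']) T hT (δ / 2) (by linarith) hI
  refine ⟨s, s', fun i => ?_⟩
  have a1 := hs i
  have a2 := hs' i
  have a3 := he i
  have e1 : ∑ s', d'.prob s' * ((1 / (T : ℝ)) * ∑ j, e i (s j) s')
      = (1 / (T : ℝ)) * ∑ j, ∑ s', d'.prob s' * e i (s j) s' := by
    rw [Finset.sum_comm]
    simp only [Finset.mul_sum]
    refine Finset.sum_congr rfl fun _ _ => Finset.sum_congr rfl fun _ _ => by ring
  have e2 : (1 / (T : ℝ)) * ∑ k, (1 / (T : ℝ)) * ∑ j, e i (s j) (s' k)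
      = (1 / (T : ℝ)) * ∑ j, (1 / (T : ℝ)) * ∑ k, e i (s j) (s' k) := by
    congr 1
    simp only [Finset.mul_sum]
    rw [Finset.sum_comm]
  simp only [e1] at a2
  rw [e2] at a2
  linarith

lemma realize {X Y : Type} [Fintype X] [Fintype Y] (f : X → Y → Bool) {MA MB : Type}
    [Fintype MA] [Fintype MB] [Nonempty MA] [Nonempty MB]
    (a : X → FinDist MA) (b : Y → FinDist MB) (c : MA → MB → FinDist Bool) :
    ∃ P : PrivSMP X Y Bool,
      P.CC = (⌈Real.logb 2 (Fintype.card MA)⌉ : ℝ) + (⌈Real.logb 2 (Fintype.card MB)⌉ : ℝ) ∧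
      ∀ x y, P.err f x y = ∑ m, (a x).prob m * ∑ m', (b y).prob m' * (c m m').prob (!f x y) := by
  refine ⟨{ MA := MA, MB := MB, RA := X → MA, RB := Y → MB, RC := MA × MB → Bool,
            dRA := FinDist.pi a, dRB := FinDist.pi b, dRC := FinDist.pi (fun z => c z.1 z.2),
            pA := fun x r => r x, pB := fun y r => r y, pC := fun m m' r => r (m, m') }, rfl, ?_⟩
  intro x y
  rw [← sum_pi_marginal a x (fun m => ∑ m', (b y).prob m' * (c m m').prob (!f x y))]
  simp only [PrivSMP.err, FinDist.probEvent, PrivSMP.randDist, FinDist.prod]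
  rw [Fintype.sum_prod_type]
  refine Finset.sum_congr rfl fun rA _ => ?_
  rw [← sum_pi_marginal b y (fun m' => (c (rA x) m').prob (!f x y)), Finset.mul_sum,
    Fintype.sum_prod_type]
  refine Finset.sum_congr rfl fun rB _ => ?_
  have h := sum_pi_marginal (fun z : MA × MB => c z.1 z.2) (rA x, rB y)
    (fun v => if v ≠ f x y then (1 : ℝ) else 0)
  have h2 : ∑ m : Bool, (c (rA x) (rB y)).prob m * (if m ≠ f x y then (1 : ℝ) else 0)
     = (c (rA x) (rB y)).prob (!f x y) := by
    cases f x y <;> simp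
  rw [h2] at h
  rw [← h, Finset.mul_sum, Finset.mul_sum]
  refine Finset.sum_congr rfl fun rC _ => ?_
  simp only
  split_ifs <;> ring

/-- the entropy in nats of a finite vector -/
noncomputable def nH {M : Type} [Fintype M] (p : M → ℝ) : ℝ := ∑ m, Real.negMulLog (p m)

lemma rej_sum {M : Type} [Fintype M] (q : FinDist M) (α : M → ℝ) (N : ℕ) (i : Fin N) (F : M → ℝ) :
    ∑ l : Fin N → M, (FinDist.pi (fun _ => q)).prob l *
      ((α (l i) * ∏ j ∈ Finset.univ.filter (fun j => j < i), (1 - α (l j))) * F (l i))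
    = (1 - ∑ m, q.prob m * α m) ^ (i : ℕ) * ∑ m, q.prob m * α m * F m := by
  have h := sum_pi_prod (I := Fin N) (fun j m => q.prob m *
    ((if j = i then α m * F m else 1) * (if j < i then 1 - α m else 1)))
  have e1 : ∀ l : Fin N → M, (FinDist.pi (fun _ => q)).prob l *
      ((α (l i) * ∏ j ∈ Finset.univ.filter (fun j => j < i), (1 - α (l j))) * F (l i)) =
      ∏ j, (q.prob (l j) *
    ((if j = i then α (l j) * F (l j) else 1) * (if j < i then 1 - α (l j) else 1))) := by
    intro l
    rw [Finset.prod_mul_distrib, Finset.prod_mul_distrib]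
    rw [Finset.prod_filter]
    simp only [Finset.prod_ite_eq', Finset.mem_univ, if_true, FinDist.pi]
    ring
  simp only [e1]
  rw [h]
  have e2 : ∀ j : Fin N, ∑ m, q.prob m *
    ((if j = i then α m * F m else 1) * (if j < i then 1 - α m else 1)) =
     (if j = i then ∑ m, q.prob m * α m * F m else 1) * (if j < i then 1 - ∑ m, q.prob m * α m else 1) := by
    intro j
    rcases lt_trichotomy j i with hj | hj | hj
    · simp only [hj, hj.ne, if_true, if_false, one_mul]
      simp [mul_sub, q.sum_one]
    · subst hj; simp [mul_assoc]
    · simp [hj.ne', hj.le, not_lt.2 hj.le, q.sum_one]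
  simp only [e2]
  rw [Finset.prod_mul_distrib]
  simp only [Finset.prod_ite_eq', Finset.mem_univ, if_true]
  rw [← Finset.prod_filter, Finset.prod_const, mul_comm]
  congr 2
  have : (Finset.univ.filter (fun j => j < i)) = Finset.Iio i := by ext; simp
  rw [this, Fin.card_Iio]

lemma rej_le_one {N : ℕ} (α : Fin N → ℝ) (h1 : ∀ j, α j ≤ 1) :
    ∑ i, α i * ∏ j ∈ Finset.univ.filter (fun j => j < i), (1 - α j) ≤ 1 := by
  have := Finset.prod_one_sub_ordered (Finset.univ : Finset (Fin N)) α
  have h2 : 0 ≤ ∏ i, (1 - α i) := Finset.prod_nonneg fun i _ => sub_nonneg.2 (h1 i)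
  linarith

lemma rejection {M : Type} [Fintype M] (p q : FinDist M) (B : ℝ) (hB : 0 < B) (N : ℕ) (hN : 0 < N) (δ : ℝ)
    (hu : 1 - δ ≤ ∑ m, min (p.prob m) (B * q.prob m)) (hδ : δ < 1 / 2)
    (hB1 : 1 ≤ B)
    (hNδ : Real.exp (-(N / (2 * B))) ≤ δ) :
    ∃ (K : (Fin N → M) → FinDist (Option (Fin N))) (t : M → ℝ),
      (∀ m, 0 ≤ t m) ∧ (∀ m, t m ≤ p.prob m) ∧ 1 - δ ≤ ∑ m, t m ∧
      ∀ F : M → ℝ, ∑ l, (FinDist.pi (fun _ => q)).prob l * ∑ i, (K l).prob (some i) * F (l i)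
        = ∑ m, t m * F m := by
  set pt : M → ℝ := fun m => min (p.prob m) (B * q.prob m) with hpt
  have hpt0 : ∀ m, 0 ≤ pt m := fun m => le_min (p.nonneg m) (mul_nonneg hB.le (q.nonneg m))
  set u := ∑ m, pt m with hu'
  have hu1 : u ≤ 1 := by
    rw [← p.sum_one]; exact Finset.sum_le_sum fun m _ => min_le_left _ _
  have hu2 : 1 / 2 < u := by linarith
  set α : M → ℝ := fun m => pt m / (B * q.prob m) with hα
  have hα0 : ∀ m, 0 ≤ α m := fun m => div_nonneg (hpt0 m) (mul_nonneg hB.le (q.nonneg m))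
  have hα1 : ∀ m, α m ≤ 1 := fun m => div_le_one_of_le₀ (min_le_right _ _) (mul_nonneg hB.le (q.nonneg m))
  have hqα : ∀ m, q.prob m * α m = pt m / B := by
    intro m
    by_cases hq : q.prob m = 0
    · have : pt m = 0 := by simp [hpt, hq, p.nonneg m]
      simp [hq, this]
    · simp only [hα]; field_simp
  set ρ : ℝ := 1 - u / B with hρ
  have hsum : ∑ m, q.prob m * α m = u / B := by simp only [hqα]; rw [← Finset.sum_div]
  have huB : u / B ≤ 1 := by rw [div_le_one hB]; linarith
  have hρ0 : 0 ≤ ρ := by linarith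
  set s : ℝ := (∑ i ∈ Finset.range N, ρ ^ i) / B with hs
  have hsu : s * u = 1 - ρ ^ N := by
    have := geom_sum_mul ρ N
    have h2 : ρ - 1 = - (u / B) := by linarith
    rw [h2] at this
    have h3 : s * u = (∑ i ∈ Finset.range N, ρ ^ i) * (u / B) := by rw [hs]; ring
    linarith
  have hspos : 0 < s := by
    apply div_pos _ hB
    calc (0:ℝ) < ρ ^ 0 := by simp
      _ ≤ _ := Finset.single_le_sum (f := fun i => ρ ^ i) (fun i _ => pow_nonneg hρ0 i) (Finset.mem_range.2 hN)
  set θ : ℝ := min 1 (1 / s) with hθ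
  have hθ0 : 0 ≤ θ := le_min zero_le_one (by positivity)
  have hθ1 : θ ≤ 1 := min_le_left _ _
  have hθs : θ * s = min s 1 := by
    rw [hθ, min_mul_of_nonneg _ _ hspos.le, one_mul, one_div, inv_mul_cancel₀ hspos.ne']
  set k : (Fin N → M) → Fin N → ℝ := fun l i =>
    θ * (α (l i) * ∏ j ∈ Finset.univ.filter (fun j => j < i), (1 - α (l j))) with hk
  have hk0 : ∀ l i, 0 ≤ k l i := fun l i => mul_nonneg hθ0 (mul_nonneg (hα0 _)
    (Finset.prod_nonneg fun j _ => sub_nonneg.2 (hα1 _)))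
  have hk1 : ∀ l, ∑ i, k l i ≤ 1 := by
    intro l
    rw [← Finset.mul_sum]
    exact mul_le_one₀ hθ1 (Finset.sum_nonneg fun i _ => (mul_nonneg (hα0 _)
      (Finset.prod_nonneg fun j _ => sub_nonneg.2 (hα1 _)))) (rej_le_one (fun i => α (l i)) fun j => hα1 _)
  refine ⟨fun l => ⟨fun o => o.elim (1 - ∑ i, k l i) (k l), ?_, ?_⟩, fun m => θ * s * pt m, ?_, ?_, ?_, ?_⟩
  · rintro (_ | i)
    · exact sub_nonneg.2 (hk1 l)
    · exact hk0 l i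
  · rw [Fintype.sum_option]; simp
  · intro m; exact mul_nonneg (mul_nonneg hθ0 hspos.le) (hpt0 m)
  · intro m
    have : θ * s ≤ 1 := by rw [hθs]; exact min_le_right _ _
    calc θ * s * pt m ≤ 1 * pt m := mul_le_mul_of_nonneg_right this (hpt0 m)
      _ ≤ _ := by rw [one_mul]; exact min_le_left _ _
  · rw [← Finset.mul_sum, ← hu', hθs]
    rcases le_total s 1 with h | h
    · rw [min_eq_left h, hsu]
      have : ρ ^ N ≤ Real.exp (-(N / (2 * B))) := by
        calc ρ ^ N ≤ (Real.exp (-(u / B))) ^ N := by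
              apply pow_le_pow_left₀ hρ0
              have := Real.add_one_le_exp (-(u / B))
              linarith
          _ = Real.exp (-(N * (u / B))) := by rw [← Real.exp_nat_mul]; congr 1; ring
          _ ≤ _ := by
              apply Real.exp_le_exp.2
              have : (N : ℝ) / (2 * B) = N * ((1 / 2) / B) := by field_simp
              rw [this]
              have : (1/2)/B ≤ u / B := by gcongr
              have hN' : (0:ℝ) ≤ N := Nat.cast_nonneg N
              nlinarith
      linarith
    · rw [min_eq_right h]; linarith
  · intro F
    simp only [Option.elim_some, Finset.mul_sum]
    rw [Finset.sum_comm]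
    have e : ∀ i : Fin N, ∑ l : Fin N → M, (FinDist.pi (fun _ => q)).prob l * (k l i * F (l i))
        = θ * (ρ ^ (i : ℕ) * ∑ m, q.prob m * α m * F m) := by
      intro i
      have := rej_sum q α N i F
      rw [hsum] at this
      rw [← this, Finset.mul_sum]
      refine Finset.sum_congr rfl fun l _ => ?_
      simp only [hk]; ring
    simp only [e]
    rw [← Finset.mul_sum, ← Finset.sum_mul, Fin.sum_univ_eq_sum_range (fun i => ρ ^ i) N]
    simp only [hqα]
    rw [← mul_assoc, Finset.mul_sum]
    refine Finset.sum_congr rfl fun m _ => ?_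
    rw [hs]; ring

lemma gibbs_pt (p t : ℝ) (hp : 0 ≤ p) (ht : 0 ≤ t) (h : t = 0 → p = 0) :
    p - t ≤ p * Real.log p - p * Real.log t := by
  rcases hp.eq_or_lt with rfl | hp
  · simpa using ht
  have ht : 0 < t := lt_of_le_of_ne ht fun h' => hp.ne' (h h'.symm)
  have := Real.log_le_sub_one_of_pos (div_pos ht hp)
  rw [Real.log_div ht.ne' hp.ne'] at this
  have h2 := mul_le_mul_of_nonneg_left this hp.le
  have h3 : p * (t / p - 1) = t - p := by field_simp
  rw [h3] at h2
  linarith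

lemma cap_pt (p q l B : ℝ) (hp : 0 ≤ p) (hq : 0 ≤ q) (hl0 : 0 < l) (hl1 : l < 1) (hB : 0 < B) (hlB : l = 1 / B) :
    (1 - l) * (q - ((1 - l) * q + l * p)) +
      l * (Real.log (B / 2) * (if B * q < p then p else 0) - ((1 - l) * q + l * p)) ≤
    Real.negMulLog ((1 - l) * q + l * p) - (1 - l) * Real.negMulLog q - l * Real.negMulLog p := by
  set t := (1 - l) * q + l * p with ht
  have ht0 : 0 ≤ t := by have : 0 ≤ 1 - l := by linarith
                         positivity
  have hz : t = 0 → q = 0 ∧ p = 0 := by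
    intro h
    have h1 : 0 ≤ (1 - l) * q := mul_nonneg (by linarith) hq
    have h2 : 0 ≤ l * p := mul_nonneg hl0.le hp
    have h3 : (1 - l) * q = 0 := by linarith
    have h4 : l * p = 0 := by linarith
    refine ⟨(mul_eq_zero.1 h3).resolve_left (by linarith), (mul_eq_zero.1 h4).resolve_left hl0.ne'⟩
  have g1 := gibbs_pt q t hq ht0 fun h => (hz h).1
  have g2 := gibbs_pt p t hp ht0 fun h => (hz h).2
  have g3 : Real.log (B / 2) * (if B * q < p then p else 0) - t ≤ p * Real.log p - p * Real.log t := by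
    split_ifs with hb
    · have hp' : 0 < p := lt_of_le_of_lt (by positivity) hb
      have htp : 0 < t := by
        have h1 : 0 ≤ (1 - l) * q := mul_nonneg (by linarith) hq
        have h2 : 0 < l * p := mul_pos hl0 hp'
        linarith
      have h5 : t ≤ 2 * p / B := by
        have : q ≤ p / B := by rw [le_div_iff₀ hB]; linarith
        have : l * p = p / B := by rw [hlB]; ring
        have : 2 * p / B = p / B + p / B := by ring
        nlinarith
      have h6 : Real.log (B / 2) ≤ Real.log p - Real.log t := by
        rw [← Real.log_div hp'.ne' htp.ne']
        apply Real.log_le_log (by positivity)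
        rw [le_div_iff₀ htp]
        calc B / 2 * t ≤ B / 2 * (2 * p / B) := by gcongr
          _ = p := by field_simp
      have := mul_le_mul_of_nonneg_left h6 hp
      linarith
    · simp only [mul_zero]; linarith
  have e : Real.negMulLog t - (1 - l) * Real.negMulLog q - l * Real.negMulLog p
     = (1 - l) * (q * Real.log q - q * Real.log t) + l * (p * Real.log p - p * Real.log t) := by
    simp only [Real.negMulLog]
    have : -t * Real.log t = -((1 - l) * q + l * p) * Real.log t := by rw [ht]
    rw [this]; ring
  rw [e]
  have a1 := mul_le_mul_of_nonneg_left g1 (by linarith : 0 ≤ 1 - l)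
  have a2 := mul_le_mul_of_nonneg_left g3 hl0.le
  linarith

noncomputable def mixQ {X M : Type} [Fintype X] [Fintype M] (P : X → FinDist M) (μ : FinDist X) : FinDist M where
  prob m := ∑ x, μ.prob x * (P x).prob m
  nonneg m := Finset.sum_nonneg fun x _ => mul_nonneg (μ.nonneg _) ((P x).nonneg _)
  sum_one := by
    rw [Finset.sum_comm]
    simp only [← Finset.mul_sum, FinDist.sum_one, mul_one]

noncomputable def capF {X M : Type} [Fintype X] [Fintype M] (P : X → FinDist M) (μ : FinDist X) : ℝ :=
  nH (mixQ P μ).prob - ∑ x, μ.prob x * nH (P x).prob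

noncomputable def dirac {X : Type} [Fintype X] (x : X) : FinDist X where
  prob y := if y = x then 1 else 0
  nonneg y := by split_ifs <;> norm_num
  sum_one := by simp

noncomputable def mixD {X : Type} [Fintype X] (μ ν : FinDist X) (l : ℝ) (h0 : 0 ≤ l) (h1 : l ≤ 1) : FinDist X where
  prob y := (1 - l) * μ.prob y + l * ν.prob y
  nonneg y := add_nonneg (mul_nonneg (by linarith) (μ.nonneg y)) (mul_nonneg h0 (ν.nonneg y))
  sum_one := by
    rw [Finset.sum_add_distrib, ← Finset.mul_sum, ← Finset.mul_sum, μ.sum_one, ν.sum_one]; ring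

lemma capF_dirac {X M : Type} [Fintype X] [Fintype M] (P : X → FinDist M) (x : X) :
    capF P (dirac x) = 0 := by
  simp [capF, mixQ, dirac]

lemma capacity {X M : Type} [Fintype X] [Fintype M] (P : X → FinDist M) (C B : ℝ) (hB : 1 < B)
    (hC : ∀ μ, capF P μ ≤ C) (hC2 : ∀ η > 0, ∃ μ, C - η < capF P μ) :
    ∃ q : FinDist M, ∀ x, Real.log (B / 2) *
      (∑ m, if B * q.prob m < (P x).prob m then (P x).prob m else 0) ≤ C + 2 := by
  have hB0 : 0 < B := by linarith
  set l := 1 / B with hl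
  have hl0 : 0 < l := by positivity
  have hl1 : l < 1 := by rw [hl, div_lt_one hB0]; exact hB
  obtain ⟨μ, hμ⟩ := hC2 l hl0
  refine ⟨mixQ P μ, fun x => ?_⟩
  set q := mixQ P μ with hq
  have h1 := hC (mixD μ (dirac x) l hl0.le hl1.le)
  have emix : ∀ m, (mixQ P (mixD μ (dirac x) l hl0.le hl1.le)).prob m
      = (1 - l) * q.prob m + l * (P x).prob m := by
    intro m
    simp [mixQ, mixD, dirac, hq, add_mul, Finset.sum_add_distrib, Finset.mul_sum, mul_assoc]
  have eH : ∑ y, (mixD μ (dirac x) l hl0.le hl1.le).prob y * nH (P y).prob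
      = (1 - l) * (∑ y, μ.prob y * nH (P y).prob) + l * nH (P x).prob := by
    simp [mixD, dirac, add_mul, Finset.sum_add_distrib, Finset.mul_sum, mul_assoc]
  have key : ∑ m, ((1 - l) * (q.prob m - ((1 - l) * q.prob m + l * (P x).prob m)) +
      l * (Real.log (B / 2) * (if B * q.prob m < (P x).prob m then (P x).prob m else 0)
        - ((1 - l) * q.prob m + l * (P x).prob m))) ≤
      ∑ m, (Real.negMulLog ((1 - l) * q.prob m + l * (P x).prob m)
        - (1 - l) * Real.negMulLog (q.prob m) - l * Real.negMulLog ((P x).prob m)) :=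
    Finset.sum_le_sum fun m _ => cap_pt _ _ l B ((P x).nonneg m) (q.nonneg m) hl0 hl1 hB0 hl
  simp only [Finset.sum_add_distrib, Finset.sum_sub_distrib, ← Finset.mul_sum, FinDist.sum_one] at key
  rw [capF, eH] at h1
  simp only [nH, emix] at h1
  rw [capF] at hμ
  simp only [nH] at hμ
  set S := ∑ m, if B * q.prob m < (P x).prob m then (P x).prob m else 0
  set H1 := ∑ m, Real.negMulLog ((1 - l) * q.prob m + l * (P x).prob m)
  set H2 := ∑ m, Real.negMulLog (q.prob m)
  set H3 := ∑ m, Real.negMulLog ((P x).prob m)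
  set H4 := ∑ x, μ.prob x * ∑ m, Real.negMulLog ((P x).prob m)
  have : l * (Real.log (B / 2) * S) ≤ l * (C + 2) := by
    have := mul_le_mul_of_nonneg_left hμ.le (by linarith : 0 ≤ 1 - l)
    nlinarith
  exact le_of_mul_le_mul_left this hl0

lemma mass_of_bad {M : Type} [Fintype M] (p q : FinDist M) (B δ : ℝ) (hB : 0 < B)
    (h : (∑ m, if B * q.prob m < p.prob m then p.prob m else 0) ≤ δ) :
    1 - δ ≤ ∑ m, min (p.prob m) (B * q.prob m) := by
  have : ∑ m, p.prob m ≤ ∑ m, (min (p.prob m) (B * q.prob m) + if B * q.prob m < p.prob m then p.prob m else 0) := by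
    refine Finset.sum_le_sum fun m _ => ?_
    have := mul_nonneg hB.le (q.nonneg m)
    split_ifs with hb
    · rw [min_eq_right hb.le]; linarith
    · rw [min_eq_left (not_lt.1 hb)]; linarith
  rw [Finset.sum_add_distrib, p.sum_one] at this
  linarith

lemma sim_side {X M : Type} [Fintype X] [Fintype M] (P : X → FinDist M) (C δ : ℝ) (hδ0 : 0 < δ)
    (hδ : δ < 1 / 2) (hC0 : 0 ≤ C)
    (hC : ∀ μ, capF P μ ≤ C) (hC2 : ∀ η > 0, ∃ μ, C - η < capF P μ) :
    ∃ (N : ℕ) (q : FinDist M) (K : X → (Fin N → M) → FinDist (Option (Fin N))) (t : X → M → ℝ),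
      ((N : ℝ) + 1 ≤ 4 / δ * Real.exp ((C + 2) / δ)) ∧
      ∀ x, (∀ m, 0 ≤ t x m) ∧ (∀ m, t x m ≤ (P x).prob m) ∧ 1 - δ ≤ ∑ m, t x m ∧
      ∀ F : M → ℝ, ∑ l, (FinDist.pi (fun _ => q)).prob l * ∑ i, (K x l).prob (some i) * F (l i)
        = ∑ m, t x m * F m := by
  set B : ℝ := 2 * Real.exp ((C + 2) / δ) with hB
  have hexp : 1 ≤ Real.exp ((C + 2) / δ) := Real.one_le_exp (by positivity)
  have hB2 : 2 ≤ B := by linarith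
  have hB0 : 0 < B := by linarith
  obtain ⟨q, hq⟩ := capacity P C B (by linarith) hC hC2
  have hlogB : Real.log (B / 2) = (C + 2) / δ := by
    rw [hB, mul_div_cancel_left₀ _ (by norm_num : (2:ℝ) ≠ 0), Real.log_exp]
  have hlog : 0 < Real.log (1 / δ) := Real.log_pos (by rw [lt_div_iff₀ hδ0]; linarith)
  set N : ℕ := ⌈2 * B * Real.log (1 / δ)⌉₊ with hN
  have hNpos : 0 < N := Nat.ceil_pos.2 (by positivity)
  have hN1 : 2 * B * Real.log (1 / δ) ≤ N := Nat.le_ceil _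
  have hN2 : (N : ℝ) < 2 * B * Real.log (1 / δ) + 1 := Nat.ceil_lt_add_one (by positivity)
  have hNδ : Real.exp (-(N / (2 * B))) ≤ δ := by
    rw [← Real.le_log_iff_exp_le hδ0]
    have : Real.log (1 / δ) ≤ N / (2 * B) := by rw [le_div_iff₀ (by positivity)]; linarith
    rw [one_div, Real.log_inv] at this
    linarith
  have := fun x => rejection (P x) q B hB0 N hNpos δ (mass_of_bad (P x) q B δ hB0 (by
    have h := hq x
    rw [hlogB, div_mul_eq_mul_div, div_le_iff₀ hδ0, mul_comm (C + 2) δ] at h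
    rw [mul_comm, mul_comm δ] at h
    rw [mul_comm (C + 2) δ] at h
    exact le_of_mul_le_mul_right h (by linarith))) hδ (by linarith) hNδ
  choose K t h1 h2 h3 h4 using this
  refine ⟨N, q, K, t, ?_, fun x => ⟨h1 x, h2 x, h3 x, h4 x⟩⟩
  have hl := Real.log_le_sub_one_of_pos (by positivity : 0 < 1 / δ)
  have e : 4 / δ * Real.exp ((C + 2) / δ) = 2 * B * (1 / δ) := by rw [hB]; ring
  rw [e]
  nlinarith

lemma entropy_eq {Ω α : Type} [Fintype Ω] [Fintype α] (p : FinDist Ω) (A : Ω → α) :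
    FinDist.entropy p A * Real.log 2 = nH (FinDist.probVal p A) := by
  have hl : Real.log 2 ≠ 0 := (Real.log_pos (by norm_num)).ne'
  rw [FinDist.entropy, Finset.sum_mul, nH]
  rw [← Finset.sum_subset (Finset.subset_univ (Finset.univ.image A))]
  · refine Finset.sum_congr rfl fun a _ => ?_
    rw [Real.negMulLog, Real.logb]; field_simp
  · intro a _ ha
    have : FinDist.probVal p A a = 0 := by
      rw [FinDist.probVal, FinDist.probEvent]
      refine Finset.sum_eq_zero fun ω _ => ?_
      rw [if_neg]
      rintro rfl
      exact ha (Finset.mem_image_of_mem _ (Finset.mem_univ _))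
    rw [this, Real.negMulLog_zero]

lemma probVal_fst {Ω α β : Type} [Fintype Ω] [Fintype α] [Fintype β] (p : FinDist Ω) (A : Ω → α) (D : Ω → β) (a : α) :
    FinDist.probVal p A a = ∑ b, FinDist.probVal p (fun ω => (A ω, D ω)) (a, b) := by
  simp only [FinDist.probVal, FinDist.probEvent]
  rw [Finset.sum_comm]
  refine Finset.sum_congr rfl fun ω _ => ?_
  by_cases h : A ω = a <;> simp [h]

lemma probVal_snd {Ω α β : Type} [Fintype Ω] [Fintype α] [Fintype β] (p : FinDist Ω) (A : Ω → α) (D : Ω → β) (b : β) :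
    FinDist.probVal p D b = ∑ a, FinDist.probVal p (fun ω => (A ω, D ω)) (a, b) := by
  simp only [FinDist.probVal, FinDist.probEvent]
  rw [Finset.sum_comm]
  refine Finset.sum_congr rfl fun ω _ => ?_
  by_cases h : D ω = b <;> simp [h]

lemma nH_equiv {α β : Type} [Fintype α] [Fintype β] (e : α ≃ β) (p : β → ℝ) :
    nH (fun a => p (e a)) = nH p := by
  simp only [nH]
  exact Equiv.sum_comp e (fun b => Real.negMulLog (p b))

lemma nH_chain {X M : Type} [Fintype X] [Fintype M] (μ : X → ℝ) (P : X → FinDist M) :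
    nH (fun z : X × M => μ z.1 * (P z.1).prob z.2) = nH μ + ∑ x, μ x * nH (P x).prob := by
  simp only [nH, Fintype.sum_prod_type, Real.negMulLog_mul, Finset.sum_add_distrib,
    ← Finset.mul_sum, ← Finset.sum_mul, FinDist.sum_one, one_mul]

lemma nH_prod {X M : Type} [Fintype X] [Fintype M] (p : FinDist X) (q : FinDist M) :
    nH (fun z : X × M => p.prob z.1 * q.prob z.2) = nH p.prob + nH q.prob := by
  rw [nH_chain p.prob (fun _ => q), ← Finset.sum_mul, p.sum_one, one_mul]

lemma sum_ind {R M : Type} [Fintype R] [Fintype M] (d : FinDist R) (g : R → M) :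
    ∑ m, ∑ r, (if g r = m then d.prob r else 0) = 1 := by
  rw [Finset.sum_comm]
  simp [d.sum_one]

namespace ShSMP
variable {X Y : Type} [Fintype X] [Fintype Y]

noncomputable def kerA (P : ShSMP X Y Bool) (x : X) : FinDist (P.MA × P.RAC) where
  prob z := P.dRAC.prob z.2 * ∑ ra, if P.pA x ra z.2 = z.1 then P.dRA.prob ra else 0
  nonneg z := mul_nonneg (P.dRAC.nonneg _) (Finset.sum_nonneg fun ra _ => by
    split_ifs
    · exact P.dRA.nonneg _
    · exact le_rfl)
  sum_one := by
    rw [Fintype.sum_prod_type, Finset.sum_comm]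
    simp only [← Finset.mul_sum, sum_ind, mul_one, P.dRAC.sum_one]

noncomputable def kerB (P : ShSMP X Y Bool) (y : Y) : FinDist (P.MB × P.RBC) where
  prob z := P.dRBC.prob z.2 * ∑ rb, if P.pB y rb z.2 = z.1 then P.dRB.prob rb else 0
  nonneg z := mul_nonneg (P.dRBC.nonneg _) (Finset.sum_nonneg fun ra _ => by
    split_ifs
    · exact P.dRB.nonneg _
    · exact le_rfl)
  sum_one := by
    rw [Fintype.sum_prod_type, Finset.sum_comm]
    simp only [← Finset.mul_sum, sum_ind, mul_one, P.dRBC.sum_one]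

lemma joint (P : ShSMP X Y Bool) (μA : FinDist X) (μB : FinDist Y) (x : X) (y : Y)
    (ma : P.MA) (mb : P.MB) (rc : P.RC) (rac : P.RAC) (rbc : P.RBC) :
    FinDist.probVal (P.space (μA.prod μB))
      (fun ω => (ω.1, (P.rvMA ω, P.rvMB ω, P.rvRC ω, P.rvRAC ω, P.rvRBC ω)))
      ((x, y), (ma, mb, rc, rac, rbc)) =
    (μA.prob x * (P.kerA x).prob (ma, rac)) * ((μB.prob y * (P.kerB y).prob (mb, rbc)) * P.dRC.prob rc) := by
  simp only [FinDist.probVal, FinDist.probEvent, space, randDist, FinDist.prod, rvMA, rvMB, rvRC, rvRAC, rvRBC,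
    kerA, kerB]
  rw [Fintype.sum_prod_type]
  rw [Finset.sum_eq_single (x, y)]
  rotate_left
  · intro z _ hz
    refine Finset.sum_eq_zero fun _ _ => ?_
    simp [hz]
  · simp
  simp only [Fintype.sum_prod_type, Finset.sum_mul, Finset.mul_sum]
  rw [Finset.sum_comm]
  refine Finset.sum_congr rfl fun rb _ => ?_
  refine Finset.sum_congr rfl fun ra _ => ?_
  rw [Finset.sum_eq_single rc, Finset.sum_eq_single rac, Finset.sum_eq_single rbc]
  · by_cases h1 : P.pA x ra rac = ma <;> by_cases h2 : P.pB y rb rbc = mb <;> simp [h1, h2]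
    ring
  · intro b _ hb; simp [hb]
  · simp
  · intro b _ hb; simp [hb]
  · simp
  · intro b _ hb; simp [hb]
  · simp

end ShSMP

namespace ShSMP
variable {X Y : Type} [Fintype X] [Fintype Y]

/-- regrouping of the referee's view -/
def viewEquiv (A B C D E : Type) : (A × B × C × D × E) ≃ ((A × D) × ((B × E) × C)) where
  toFun z := ((z.1, z.2.2.2.1), ((z.2.1, z.2.2.2.2), z.2.2.1))
  invFun w := (w.1.1, w.2.1.1, w.2.2, w.1.2, w.2.1.2)
  left_inv _ := rfl
  right_inv _ := rfl

/-- regrouping of inputs and view -/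
def jointEquiv (X Y A B C D E : Type) :
    ((X × Y) × (A × B × C × D × E)) ≃ ((X × (A × D)) × ((Y × (B × E)) × C)) where
  toFun z := ((z.1.1, (z.2.1, z.2.2.2.2.1)), ((z.1.2, (z.2.2.1, z.2.2.2.2.2)), z.2.2.2.1))
  invFun w := ((w.1.1, w.2.1.1), (w.1.2.1, w.2.1.2.1, w.2.2, w.1.2.2, w.2.1.2.2))
  left_inv _ := rfl
  right_inv _ := rfl

/-- joint distribution -/
noncomputable def _root_.FinDist.jnt {X M : Type} [Fintype X] [Fintype M] (μ : FinDist X) (P : X → FinDist M) :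
    FinDist (X × M) where
  prob z := μ.prob z.1 * (P z.1).prob z.2
  nonneg z := mul_nonneg (μ.nonneg _) ((P _).nonneg _)
  sum_one := by
    simp only [Fintype.sum_prod_type, ← Finset.mul_sum, FinDist.sum_one, mul_one]

lemma IL_prod (P : ShSMP X Y Bool) (μA : FinDist X) (μB : FinDist Y) :
    P.IL (μA.prod μB) * Real.log 2 = capF P.kerA μA + capF P.kerB μB := by
  have hJ : FinDist.probVal (P.space (μA.prod μB))
      (fun ω => (ω.1, (P.rvMA ω, P.rvMB ω, P.rvRC ω, P.rvRAC ω, P.rvRBC ω))) =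
      fun z => (((μA.jnt P.kerA).prod ((μB.jnt P.kerB).prod P.dRC)).prob (jointEquiv _ _ _ _ _ _ _ z)) := by
    funext z
    obtain ⟨⟨x, y⟩, ma, mb, rc, rac, rbc⟩ := z
    exact P.joint μA μB x y ma mb rc rac rbc
  have hX : FinDist.probVal (P.space (μA.prod μB)) (fun ω => ω.1) = (μA.prod μB).prob := by
    funext z
    obtain ⟨x, y⟩ := z
    rw [probVal_fst _ _ (fun ω => (P.rvMA ω, P.rvMB ω, P.rvRC ω, P.rvRAC ω, P.rvRBC ω)), hJ]
    rw [← Equiv.sum_comp (viewEquiv _ _ _ _ _).symm]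
    simp only [jointEquiv, viewEquiv, Equiv.coe_fn_mk, Equiv.coe_fn_symm_mk, FinDist.prod, FinDist.jnt]
    rw [Fintype.sum_prod_type]
    simp only [← Finset.mul_sum, Fintype.sum_prod_type (α₁ := P.MB × P.RBC), FinDist.sum_one, mul_one,
      ← Finset.sum_mul, Prod.mk.eta]
  have hM : FinDist.probVal (P.space (μA.prod μB))
      (fun ω => (P.rvMA ω, P.rvMB ω, P.rvRC ω, P.rvRAC ω, P.rvRBC ω)) =
      fun z => ((mixQ P.kerA μA).prod ((mixQ P.kerB μB).prod P.dRC)).prob (viewEquiv _ _ _ _ _ z) := by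
    funext z
    obtain ⟨ma, mb, rc, rac, rbc⟩ := z
    rw [probVal_snd _ (fun ω => ω.1), hJ]
    simp only [jointEquiv, viewEquiv, Equiv.coe_fn_mk, FinDist.prod, FinDist.jnt, mixQ]
    rw [Fintype.sum_prod_type]
    simp only [Finset.sum_mul, ← Finset.mul_sum]
  rw [IL, FinDist.mutualInfo, sub_mul, add_mul, entropy_eq, entropy_eq, entropy_eq, hJ, hX, hM,
    nH_equiv, nH_equiv]
  have e1 := nH_prod (μA.jnt P.kerA) ((μB.jnt P.kerB).prod P.dRC)
  have e2 := nH_prod (μB.jnt P.kerB) P.dRC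
  have e3 := nH_prod (mixQ P.kerA μA) ((mixQ P.kerB μB).prod P.dRC)
  have e4 := nH_prod (mixQ P.kerB μB) P.dRC
  have e5 := nH_prod μA μB
  have e6 := nH_chain μA.prob P.kerA
  have e7 := nH_chain μB.prob P.kerB
  simp only [capF]
  change nH (FinDist.prod _ _).prob = _ at e1
  change nH (FinDist.prod _ _).prob = _ at e2
  change nH (FinDist.prod _ _).prob = _ at e3
  change nH (FinDist.prod _ _).prob = _ at e4
  change nH (FinDist.prod _ _).prob = _ at e5
  change nH (FinDist.jnt _ _).prob = _ at e6
  change nH (FinDist.jnt _ _).prob = _ at e7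
  rw [e1, e2, e3, e4, e5, e6, e7]
  ring

lemma _root_.probVal_mem {Ω α : Type} [Fintype Ω] (p : FinDist Ω) (A : Ω → α) (a : α) :
    0 ≤ FinDist.probVal p A a ∧ FinDist.probVal p A a ≤ 1 := by
  constructor
  · refine Finset.sum_nonneg fun ω _ => ?_
    split_ifs
    · exact p.nonneg _
    · exact le_rfl
  · rw [← p.sum_one]
    refine Finset.sum_le_sum fun ω _ => ?_
    split_ifs
    · exact le_rfl
    · exact p.nonneg _

lemma _root_.nH_nonneg {α : Type} [Fintype α] (p : α → ℝ) (h : ∀ a, 0 ≤ p a ∧ p a ≤ 1) : 0 ≤ nH p :=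
  Finset.sum_nonneg fun a _ => Real.negMulLog_nonneg (h a).1 (h a).2

lemma _root_.nH_le {α : Type} [Fintype α] (p : α → ℝ) (h : ∀ a, 0 ≤ p a ∧ p a ≤ 1) : nH p ≤ Fintype.card α := by
  calc nH p ≤ ∑ _a : α, (1 : ℝ) := by
        refine Finset.sum_le_sum fun a _ => ?_
        have := Real.negMulLog_le_one_sub_self (h a).1
        have := (h a).1
        linarith
    _ = _ := by simp

lemma IL_bdd (P : ShSMP X Y Bool) : BddAbove (Set.range fun μ : FinDist (X × Y) => P.IL μ) := by
  have hl : 0 < Real.log 2 := Real.log_pos (by norm_num)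
  refine ⟨((Fintype.card (X × Y) : ℝ) + Fintype.card (P.MA × P.MB × P.RC × P.RAC × P.RBC)) / Real.log 2, ?_⟩
  rintro _ ⟨μ, rfl⟩
  simp only
  rw [le_div_iff₀ hl, IL, FinDist.mutualInfo, sub_mul, add_mul, entropy_eq, entropy_eq, entropy_eq]
  have h1 := nH_le _ (probVal_mem (P.space μ) (fun ω => ω.1))
  have h2 := nH_le _ (probVal_mem (P.space μ) (fun ω => (P.rvMA ω, P.rvMB ω, P.rvRC ω, P.rvRAC ω, P.rvRBC ω)))
  have h3 := nH_nonneg _ (probVal_mem (P.space μ) (fun ω => (ω.1, P.rvMA ω, P.rvMB ω, P.rvRC ω, P.rvRAC ω, P.rvRBC ω)))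
  linarith

lemma caps (P : ShSMP X Y Bool) [Nonempty X] [Nonempty Y] : ∃ CA CB : ℝ, 0 ≤ CA ∧ 0 ≤ CB ∧
    (∀ μ, capF P.kerA μ ≤ CA) ∧ (∀ η > 0, ∃ μ, CA - η < capF P.kerA μ) ∧
    (∀ μ, capF P.kerB μ ≤ CB) ∧ (∀ η > 0, ∃ μ, CB - η < capF P.kerB μ) ∧
    CA + CB ≤ P.ILmax * Real.log 2 := by
  have hl : 0 < Real.log 2 := Real.log_pos (by norm_num)
  have hsum : ∀ μA μB, capF P.kerA μA + capF P.kerB μB ≤ P.ILmax * Real.log 2 := by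
    intro μA μB
    rw [← IL_prod]
    exact mul_le_mul_of_nonneg_right (le_ciSup P.IL_bdd (μA.prod μB)) hl.le
  obtain ⟨x0⟩ := ‹Nonempty X›
  obtain ⟨y0⟩ := ‹Nonempty Y›
  have : Nonempty (FinDist X) := ⟨dirac x0⟩
  have : Nonempty (FinDist Y) := ⟨dirac y0⟩
  have bA : BddAbove (Set.range fun μ => capF P.kerA μ) := by
    refine ⟨P.ILmax * Real.log 2, ?_⟩
    rintro _ ⟨μ, rfl⟩
    have := hsum μ (dirac y0)
    rw [capF_dirac] at this; simpa using this
  have bB : BddAbove (Set.range fun μ => capF P.kerB μ) := by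
    refine ⟨P.ILmax * Real.log 2, ?_⟩
    rintro _ ⟨μ, rfl⟩
    have := hsum (dirac x0) μ
    rw [capF_dirac] at this; simpa using this
  refine ⟨⨆ μ, capF P.kerA μ, ⨆ μ, capF P.kerB μ, ?_, ?_, le_ciSup bA, ?_, le_ciSup bB, ?_, ?_⟩
  · rw [← capF_dirac P.kerA x0]; exact le_ciSup bA _
  · rw [← capF_dirac P.kerB y0]; exact le_ciSup bB _
  · intro η hη; exact exists_lt_of_lt_ciSup (by linarith)
  · intro η hη; exact exists_lt_of_lt_ciSup (by linarith)
  · have : (⨆ μ, capF P.kerA μ) ≤ P.ILmax * Real.log 2 - ⨆ μ, capF P.kerB μ := by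
      refine ciSup_le fun μA => ?_
      have : (⨆ μ, capF P.kerB μ) ≤ P.ILmax * Real.log 2 - capF P.kerA μA :=
        ciSup_le fun μB => by linarith [hsum μA μB]
      linarith
    linarith

lemma sum_kerA (P : ShSMP X Y Bool) (x : X) (G : P.MA × P.RAC → ℝ) :
    ∑ z, (P.kerA x).prob z * G z
      = ∑ ra, P.dRA.prob ra * ∑ rac, P.dRAC.prob rac * G (P.pA x ra rac, rac) := by
  simp only [kerA, Fintype.sum_prod_type, Finset.mul_sum, Finset.sum_mul]
  rw [Finset.sum_comm]
  symm
  rw [Finset.sum_comm]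
  symm
  refine Finset.sum_congr rfl fun rac _ => ?_
  rw [Finset.sum_comm]
  refine Finset.sum_congr rfl fun ra _ => ?_
  rw [Finset.sum_eq_single (P.pA x ra rac)]
  · simp; ring
  · intro b _ hb; simp [hb.symm]
  · simp

lemma sum_kerB (P : ShSMP X Y Bool) (y : Y) (G : P.MB × P.RBC → ℝ) :
    ∑ z, (P.kerB y).prob z * G z
      = ∑ rb, P.dRB.prob rb * ∑ rbc, P.dRBC.prob rbc * G (P.pB y rb rbc, rbc) := by
  simp only [kerB, Fintype.sum_prod_type, Finset.mul_sum, Finset.sum_mul]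
  rw [Finset.sum_comm]
  symm
  rw [Finset.sum_comm]
  symm
  refine Finset.sum_congr rfl fun rac _ => ?_
  rw [Finset.sum_comm]
  refine Finset.sum_congr rfl fun ra _ => ?_
  rw [Finset.sum_eq_single (P.pB y ra rac)]
  · simp; ring
  · intro b _ hb; simp [hb.symm]
  · simp

/-- the original error in terms of kernels -/
lemma err_eq (P : ShSMP X Y Bool) (f : X → Y → Bool) (x : X) (y : Y) :
    P.err f x y = ∑ z, (P.kerA x).prob z * ∑ w, (P.kerB y).prob w *
      ∑ rc, P.dRC.prob rc * (if P.pC z.1 w.1 rc z.2 w.2 ≠ f x y then 1 else 0) := by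
  rw [sum_kerA]
  simp only [sum_kerB]
  simp only [err, FinDist.probEvent, randDist, FinDist.prod, Fintype.sum_prod_type]
  refine Finset.sum_congr rfl fun ra _ => ?_
  simp only [Finset.mul_sum]
  symm
  rw [Finset.sum_comm]
  symm
  refine Finset.sum_congr rfl fun rb _ => ?_
  rw [Finset.sum_comm]
  refine Finset.sum_congr rfl fun rac _ => ?_
  rw [Finset.sum_comm]
  refine Finset.sum_congr rfl fun rbc _ => ?_
  refine Finset.sum_congr rfl fun rc _ => ?_
  split_ifs <;> ring

end ShSMP

noncomputable def coin : FinDist Bool where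
  prob _ := 1 / 2
  nonneg _ := by norm_num
  sum_one := by simp

noncomputable def refd {M M' : Type} {N N' : ℕ} (out : M → M' → FinDist Bool) (l : Fin N → M) (l' : Fin N' → M') :
    Option (Fin N) → Option (Fin N') → FinDist Bool
  | some i, some j => out (l i) (l' j)
  | _, _ => coin

noncomputable def unifProd {O : Type} [Fintype O] (T : ℕ) (hT : 0 < T) (K : Fin T → FinDist O) : FinDist (Fin T × O) where
  prob z := 1 / (T : ℝ) * (K z.1).prob z.2
  nonneg z := mul_nonneg (by positivity) ((K _).nonneg _)
  sum_one := by
    have : (T : ℝ) ≠ 0 := by positivity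
    simp only [Fintype.sum_prod_type, ← Finset.mul_sum, FinDist.sum_one]
    simp [this]

lemma prob_le_one {Ω : Type} [Fintype Ω] (p : FinDist Ω) (a : Ω) : p.prob a ≤ 1 := by
  rw [← p.sum_one]
  exact Finset.single_le_sum (f := p.prob) (fun i _ => p.nonneg i) (Finset.mem_univ a)

lemma avg_nonneg {Ω : Type} [Fintype Ω] (p : FinDist Ω) (g : Ω → ℝ) (h : ∀ a, 0 ≤ g a) :
    0 ≤ ∑ a, p.prob a * g a := Finset.sum_nonneg fun a _ => mul_nonneg (p.nonneg a) (h a)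

lemma avg_le_one {Ω : Type} [Fintype Ω] (p : FinDist Ω) (g : Ω → ℝ) (h : ∀ a, g a ≤ 1) :
    ∑ a, p.prob a * g a ≤ 1 := by
  calc _ ≤ ∑ a, p.prob a * 1 := Finset.sum_le_sum fun a _ => mul_le_mul_of_nonneg_left (h a) (p.nonneg a)
    _ = 1 := by simp [p.sum_one]

lemma refd_sum {M M' : Type} {N N' : ℕ} (out : M → M' → FinDist Bool) (l : Fin N → M) (l' : Fin N' → M')
    (k : FinDist (Option (Fin N))) (k' : FinDist (Option (Fin N'))) (b : Bool) :
    ∑ o, k.prob o * ∑ o', k'.prob o' * (refd out l l' o o').prob b =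
    1 / 2 + ∑ i, k.prob (some i) * ∑ j, k'.prob (some j) * ((out (l i) (l' j)).prob b - 1 / 2) := by
  obtain ⟨g, hg⟩ : ∃ g : Option (Fin N) → Option (Fin N') → ℝ,
      ∀ o o', g o o' = (refd out l l' o o').prob b - 1 / 2 := ⟨_, fun _ _ => rfl⟩
  have h : ∀ o o', (refd out l l' o o').prob b = 1 / 2 + g o o' := by
    intro o o'; rw [hg]; ring
  simp only [h, mul_add, Finset.sum_add_distrib, ← Finset.sum_mul, k.sum_one, k'.sum_one, one_mul]
  congr 1
  simp only [hg]
  rw [Fintype.sum_option]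
  have h0 : ∀ o', (refd out l l' none o').prob b - 1 / 2 = 0 := by
    intro o'; simp [refd, coin]
  simp only [h0, mul_zero, Finset.sum_const_zero, zero_add]
  refine Finset.sum_congr rfl fun i _ => ?_
  rw [Fintype.sum_option]
  have h1 : (refd out l l' (some i) none).prob b - 1 / 2 = 0 := by simp [refd, coin]
  rw [h1]
  simp [refd]

lemma assemble {X Y M M' : Type} [Fintype X] [Fintype Y] [Fintype M] [Fintype M'] (f : X → Y → Bool)
    (ε δ1 δ2 : ℝ) (hδ1 : 0 < δ1) (hδ1' : δ1 < 1 / 2) (hδ2 : 0 < δ2)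
    (out : M → M' → FinDist Bool) {N N' : ℕ} (q : FinDist M) (q' : FinDist M')
    (K : X → (Fin N → M) → FinDist (Option (Fin N))) (t : X → M → ℝ)
    (K' : Y → (Fin N' → M') → FinDist (Option (Fin N'))) (t' : Y → M' → ℝ)
    (h : ∀ x, 1 - δ1 ≤ ∑ m, t x m ∧
      ∀ F : M → ℝ, ∑ l, (FinDist.pi (fun _ => q)).prob l * ∑ i, (K x l).prob (some i) * F (l i)
        = ∑ m, t x m * F m)
    (h' : ∀ y, 1 - δ1 ≤ ∑ m, t' y m ∧
      ∀ F : M' → ℝ, ∑ l, (FinDist.pi (fun _ => q')).prob l * ∑ i, (K' y l).prob (some i) * F (l i)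
        = ∑ m, t' y m * F m)
    (herr : ∀ x y, ∑ m, t x m * ∑ m', t' y m' * (out m m').prob (!f x y) ≤ ε)
    (T : ℕ) (hT : 0 < T) 
    (hI : (Fintype.card (X × Y) : ℝ) < Real.exp (2 * T * (δ2 / 2) ^ 2)) :
    ∃ P : PrivSMP X Y Bool, P.Computes f (ε + δ1 + δ2) ∧
      P.CC = (⌈Real.logb 2 (T * (N + 1))⌉ : ℝ) + (⌈Real.logb 2 (T * (N' + 1))⌉ : ℝ) := by
  have : Nonempty (Fin T) := ⟨⟨0, hT⟩⟩
  set e : X × Y → (Fin N → M) → (Fin N' → M') → ℝ := fun z l l' =>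
    ∑ o, (K z.1 l).prob o * ∑ o', (K' z.2 l').prob o' * (refd out l l' o o').prob (!f z.1 z.2) with he
  have hav : ∀ z, ∑ l, (FinDist.pi (fun _ => q)).prob l * ∑ l', (FinDist.pi (fun _ => q')).prob l' * e z l l'
      ≤ ε + δ1 := by
    rintro ⟨x, y⟩
    simp only [he, refd_sum]
    set W : M → M' → ℝ := fun m m' => (out m m').prob (!f x y) - 1 / 2 with hW
    have s1 : ∀ l : Fin N → M, ∑ l', (FinDist.pi (fun _ => q')).prob l' *
        (1 / 2 + ∑ i, (K x l).prob (some i) * ∑ j, (K' y l').prob (some j) * W (l i) (l' j))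
        = 1 / 2 + ∑ i, (K x l).prob (some i) * ∑ m', t' y m' * W (l i) m' := by
      intro l
      simp only [mul_add, Finset.sum_add_distrib, ← Finset.sum_mul, FinDist.sum_one, one_mul]
      congr 1
      simp only [← (h' y).2]
      simp only [Finset.mul_sum]
      rw [Finset.sum_comm]
      refine Finset.sum_congr rfl fun i _ => Finset.sum_congr rfl fun l' _ =>
        Finset.sum_congr rfl fun j _ => ?_
      ring
    change ∑ l, (FinDist.pi (fun _ => q)).prob l * ∑ l', (FinDist.pi (fun _ => q')).prob l' *
        (1 / 2 + ∑ i, (K x l).prob (some i) * ∑ j, (K' y l').prob (some j) * W (l i) (l' j)) ≤ _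
    simp only [s1]
    have s2 : ∑ l, (FinDist.pi (fun _ => q)).prob l *
        (1 / 2 + ∑ i, (K x l).prob (some i) * ∑ m', t' y m' * W (l i) m')
        = 1 / 2 + ∑ m, t x m * ∑ m', t' y m' * W m m' := by
      simp only [mul_add, Finset.sum_add_distrib, ← Finset.sum_mul, FinDist.sum_one, one_mul]
      rw [← (h x).2 (fun m => ∑ m', t' y m' * W m m')]
    rw [s2]
    simp only [hW, mul_sub, Finset.sum_sub_distrib, ← Finset.sum_mul]
    have h1 := herr x y
    have h2 := (h x).1
    have h3 := (h' y).1
    nlinarith [mul_nonneg (sub_nonneg.2 h2) (sub_nonneg.2 h3)]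
  obtain ⟨s, s', hs⟩ := newman_two (FinDist.pi (fun _ => q)) (FinDist.pi (fun _ => q')) e
    (fun z l l' => avg_nonneg _ _ fun o => avg_nonneg _ _ fun o' => FinDist.nonneg _ _)
    (fun z l l' => avg_le_one _ _ fun o => avg_le_one _ _ fun o' => prob_le_one _ _)
    T hT δ2 (ε + δ1) hδ2 hI hav
  obtain ⟨P, hP1, hP2⟩ := realize f (fun x => unifProd T hT (fun j => K x (s j)))
    (fun y => unifProd T hT (fun j => K' y (s' j)))
    (fun z w => refd out (s z.1) (s' w.1) z.2 w.2)
  refine ⟨P, fun x y => ?_, ?_⟩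
  · rw [hP2]
    refine le_trans (le_of_eq ?_) (hs (x, y))
    simp only [he, unifProd, Fintype.sum_prod_type, Finset.mul_sum]
    refine Finset.sum_congr rfl fun j _ => ?_
    symm
    rw [Finset.sum_comm]
    refine Finset.sum_congr rfl fun o _ => Finset.sum_congr rfl fun k _ =>
      Finset.sum_congr rfl fun o' _ => ?_
    ring
  · rw [hP1]
    simp

noncomputable def outD {X Y : Type} [Fintype X] [Fintype Y] (P : ShSMP X Y Bool) (z : P.MA × P.RAC)
    (w : P.MB × P.RBC) : FinDist Bool where
  prob b := ∑ rc, if P.pC z.1 w.1 rc z.2 w.2 = b then P.dRC.prob rc else 0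
  nonneg b := Finset.sum_nonneg fun rc _ => by
    split_ifs
    · exact P.dRC.nonneg _
    · exact le_rfl
  sum_one := by
    rw [Finset.sum_comm]
    simp [P.dRC.sum_one]

lemma main_cost {X Y : Type} [Fintype X] [Fintype Y] [Nonempty X] [Nonempty Y] (f : X → Y → Bool)
    (ε δ1 δ2 : ℝ) (hε : 0 ≤ ε) (hδ1 : 0 < δ1) (hδ2 : 0 < δ2) (hsum : ε + δ1 + δ2 < 1 / 2)
    (P : ShSMP X Y Bool) (hP : P.Computes f ε) (T : ℕ) (hT : 0 < T)
    (hI : (Fintype.card (X × Y) : ℝ) < Real.exp (2 * T * (δ2 / 2) ^ 2)) :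
    ∃ Q : PrivSMP X Y Bool, Q.Computes f (ε + δ1 + δ2) ∧
      Q.CC ≤ P.ILmax / δ1 + 10 / δ1 + 6 + 2 * Real.logb 2 T := by
  have hδ1' : δ1 < 1 / 2 := by linarith
  obtain ⟨CA, CB, hCA0, hCB0, hCA1, hCA2, hCB1, hCB2, hIL⟩ := P.caps
  obtain ⟨N, q, K, t, hN, h⟩ := sim_side P.kerA CA δ1 hδ1 hδ1' hCA0 hCA1 hCA2
  obtain ⟨N', q', K', t', hN', h'⟩ := sim_side P.kerB CB δ1 hδ1 hδ1' hCB0 hCB1 hCB2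
  obtain ⟨Q, hQ1, hQ2⟩ := assemble f ε δ1 δ2 hδ1 hδ1' hδ2 (outD P) q q' K t K' t'
    (fun x => ⟨(h x).2.2.1, (h x).2.2.2⟩) (fun y => ⟨(h' y).2.2.1, (h' y).2.2.2⟩)
    (by
      intro x y
      refine le_trans ?_ (hP x y)
      rw [ShSMP.err_eq]
      refine Finset.sum_le_sum (N := ℝ) fun m _ => ?_
      have e : ∀ m', (outD P m m').prob (!f x y) =
          ∑ rc, P.dRC.prob rc * (if P.pC m.1 m'.1 rc m.2 m'.2 ≠ f x y then 1 else 0) := by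
        intro m'
        simp only [outD]
        refine Finset.sum_congr rfl fun rc _ => ?_
        cases P.pC m.1 m'.1 rc m.2 m'.2 <;> cases f x y <;> simp
      simp only [← e]
      refine mul_le_mul ((h x).2.1 m) (Finset.sum_le_sum fun m' _ => ?_) ?_ (FinDist.nonneg _ _)
      · exact mul_le_mul_of_nonneg_right ((h' y).2.1 m') (FinDist.nonneg _ _)
      · exact Finset.sum_nonneg fun m' _ => mul_nonneg ((h' y).1 m') (FinDist.nonneg _ _))
    T hT hI
  refine ⟨Q, hQ1, ?_⟩
  rw [hQ2]
  have hl : 0 < Real.log 2 := Real.log_pos (by norm_num)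
  have hTpos : (0:ℝ) < T := by exact_mod_cast hT
  have side : ∀ (N : ℕ) (C : ℝ), ((N : ℝ) + 1 ≤ 4 / δ1 * Real.exp ((C + 2) / δ1)) →
      (⌈Real.logb 2 (T * (N + 1))⌉ : ℝ) ≤ C / Real.log 2 / δ1 + 5 / δ1 + 3 + Real.logb 2 T := by
    intro N C hN
    have h1 := (Int.ceil_lt_add_one (Real.logb 2 (T * ((N : ℝ) + 1)))).le
    have hNp : (0:ℝ) < (N : ℝ) + 1 := by positivity
    rw [Real.logb_mul hTpos.ne' hNp.ne'] at h1 ⊢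
    have h2 : Real.logb 2 ((N : ℝ) + 1) ≤ Real.logb 2 (4 / δ1 * Real.exp ((C + 2) / δ1)) :=
      Real.logb_le_logb_of_le (by norm_num) hNp hN
    have h3 : Real.logb 2 (4 / δ1 * Real.exp ((C + 2) / δ1)) ≤ 2 + C / Real.log 2 / δ1 + 5 / δ1 := by
      rw [Real.logb, Real.log_mul (by positivity) (Real.exp_pos _).ne', Real.log_exp, div_eq_mul_one_div 4 δ1,
        Real.log_mul (by norm_num) (by positivity)]
      have h4 : Real.log 4 = 2 * Real.log 2 := by
        rw [show (4:ℝ) = 2 ^ 2 by norm_num, Real.log_pow]; norm_num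
      have h5 := Real.log_le_sub_one_of_pos (by positivity : 0 < 1 / δ1)
      have h6 := Real.log_two_gt_d9
      rw [div_le_iff₀ hl, h4]
      have e1 : (2 + C / Real.log 2 / δ1 + 5 / δ1) * Real.log 2
          = 2 * Real.log 2 + C / δ1 + 5 * Real.log 2 * (1 / δ1) := by field_simp
      rw [e1]
      have e2 : (C + 2) / δ1 = C / δ1 + 2 * (1 / δ1) := by ring
      rw [e2]
      have h7 : 0 < 1 / δ1 := by positivity
      nlinarith
    linarith
  have a1 := side N CA hN
  have a2 := side N' CB hN'
  have a3 : CA / Real.log 2 / δ1 + CB / Real.log 2 / δ1 ≤ P.ILmax / δ1 := by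
    rw [← add_div, ← add_div]
    gcongr
    rw [div_le_iff₀ hl]; exact hIL
  have a4 : 10 / δ1 = 5 / δ1 + 5 / δ1 := by ring
  linarith

lemma PrivSMP.CC_nonneg {X Y Z : Type} [Fintype X] [Fintype Y] [Fintype Z] (P : PrivSMP X Y Z) : 0 ≤ P.CC := by
  have h : ∀ n : ℕ, 0 < n → (0:ℝ) ≤ (⌈Real.logb 2 (n : ℝ)⌉ : ℝ) := by
    intro n hn
    have : 0 ≤ Real.logb 2 (n : ℝ) := Real.logb_nonneg (by norm_num) (by exact_mod_cast hn)
    exact this.trans (Int.le_ceil _)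
  exact add_nonneg (h _ Fintype.card_pos) (h _ Fintype.card_pos)

lemma CCprivf_nonneg {X Y Z : Type} [Fintype X] [Fintype Y] [Fintype Z] (f : X → Y → Z) (ε : ℝ) :
    0 ≤ CCprivf f ε := by
  apply Real.sInf_nonneg
  rintro _ ⟨P, -, rfl⟩
  exact P.CC_nonneg

lemma main_one {X Y : Type} [Fintype X] [Fintype Y] [Nonempty X] [Nonempty Y] (f : X → Y → Bool)
    (ε δ1 δ2 : ℝ) (hε : 0 ≤ ε) (hδ1 : 0 < δ1) (hδ2 : 0 < δ2) (hsum : ε + δ1 + δ2 < 1 / 2)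
    (P : ShSMP X Y Bool) (hP : P.Computes f ε) :
    P.ILmax ≥ δ1 * (CCprivf f (ε + δ1 + δ2)
          - g2 (Real.logb 2 (Fintype.card X)) (Real.logb 2 (Fintype.card Y)) δ2 - 4)
        - 2 * g1 (CCprivf f ε) := by
  have hl : 0 < Real.log 2 := Real.log_pos (by norm_num)
  set nA := Real.logb 2 (Fintype.card X) with hnA
  set nB := Real.logb 2 (Fintype.card Y) with hnB
  have hcX : (0:ℝ) < Fintype.card X := by exact_mod_cast Fintype.card_pos
  have hcY : (0:ℝ) < Fintype.card Y := by exact_mod_cast Fintype.card_pos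
  have hA0 : 0 ≤ nA := Real.logb_nonneg (by norm_num) (by exact_mod_cast Fintype.card_pos)
  have hB0 : 0 ≤ nB := Real.logb_nonneg (by norm_num) (by exact_mod_cast Fintype.card_pos)
  have hle : log2e = 1 / Real.log 2 := by rw [log2e, Real.logb, Real.log_exp]
  set V : ℝ := 2 * (nA + nB) / (δ2 ^ 2 * log2e) with hV
  have hle0 : 0 < log2e := by rw [hle]; positivity
  have hV0 : 0 ≤ V := by positivity
  set T : ℕ := ⌊V⌋₊ + 1 with hT
  have hT1 : V < T := by rw [hT]; push_cast; exact Nat.lt_floor_add_one V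
  have hT2 : (T : ℝ) ≤ V + 1 := by rw [hT]; push_cast; linarith [Nat.floor_le hV0]
  have hTpos : (0:ℝ) < T := by linarith
  have hI : (Fintype.card (X × Y) : ℝ) < Real.exp (2 * T * (δ2 / 2) ^ 2) := by
    rw [Fintype.card_prod]; push_cast
    rw [← Real.log_lt_iff_lt_exp (by positivity), Real.log_mul hcX.ne' hcY.ne']
    have e : Real.log (Fintype.card X) + Real.log (Fintype.card Y) = (nA + nB) * Real.log 2 := by
      rw [hnA, hnB, Real.logb, Real.logb]; field_simp
    rw [e]
    have e2 : V * δ2 ^ 2 = 2 * ((nA + nB) * Real.log 2) := by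
      rw [hV, hle]; field_simp
    have := mul_lt_mul_of_pos_right hT1 (by positivity : 0 < δ2 ^ 2)
    nlinarith
  obtain ⟨Q, hQ1, hQ2⟩ := main_cost f ε δ1 δ2 hε hδ1 hδ2 hsum P hP T (Nat.succ_pos _) hI
  have h1 : CCprivf f (ε + δ1 + δ2) ≤ Q.CC := csInf_le
    ⟨0, by rintro _ ⟨P, -, rfl⟩; exact P.CC_nonneg⟩ ⟨Q, hQ1, rfl⟩
  have h2 : Real.logb 2 T ≤ Real.logb 2 (V + 1) := Real.logb_le_logb_of_le (by norm_num) hTpos hT2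
  have h3 : g2 nA nB δ2 = 2 * Real.logb 2 (V + 1) + 2 := rfl
  have h4 : 10 ≤ g1 (CCprivf f ε) := by
    have := CCprivf_nonneg f ε
    have := Real.logb_nonneg (b := 2) (by norm_num) (by linarith : 1 ≤ CCprivf f ε + 1)
    rw [g1]; linarith
  have h5 : CCprivf f (ε + δ1 + δ2) - g2 nA nB δ2 - 4 ≤ P.ILmax / δ1 + 10 / δ1 := by linarith
  have h6 := mul_le_mul_of_nonneg_left h5 hδ1.le
  have h7 : δ1 * (P.ILmax / δ1 + 10 / δ1) = P.ILmax + 10 := by field_simp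
  linarith

lemma exists_proto {X Y : Type} [Fintype X] [Fintype Y] [Nonempty X] [Nonempty Y] (f : X → Y → Bool)
    (ε : ℝ) (hε : 0 ≤ ε) : ∃ P : ShSMP X Y Bool, P.Computes f ε := by
  refine ⟨{ MA := X, MB := Y, RA := Unit, RB := Unit, RC := Unit, RAC := Unit, RBC := Unit,
            dRA := dirac (), dRB := dirac (), dRC := dirac (), dRAC := dirac (), dRBC := dirac (),
            pA := fun x _ _ => x, pB := fun y _ _ => y, pC := fun x y _ _ _ => f x y }, fun x y => ?_⟩
  simpa [ShSMP.err, FinDist.probEvent] using hε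

/-- Lower bound on the information leakage of any shared-randomness
SMP protocol in terms of private-coin communication complexity. -/
theorem il_vs_ccpriv (X Y : Type) [Fintype X] [Fintype Y] [Nonempty X] [Nonempty Y]
    (f : X → Y → Bool) (ε δ1 δ2 : ℝ)
    (hε : 0 ≤ ε) (hδ1 : 0 < δ1) (hδ2 : 0 < δ2) (hsum : ε + δ1 + δ2 < 1 / 2) :
    (∀ P : ShSMP X Y Bool, P.Computes f ε →
      P.ILmax ≥ δ1 * (CCprivf f (ε + δ1 + δ2)
          - g2 (Real.logb 2 (Fintype.card X)) (Real.logb 2 (Fintype.card Y)) δ2 - 4)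
        - 2 * g1 (CCprivf f ε)) ∧
    ILf f ε ≥ δ1 * (CCprivf f (ε + δ1 + δ2)
        - g2 (Real.logb 2 (Fintype.card X)) (Real.logb 2 (Fintype.card Y)) δ2 - 4)
      - 2 * g1 (CCprivf f ε) := by
  have h := fun P hP => main_one f ε δ1 δ2 hε hδ1 hδ2 hsum P hP
  refine ⟨h, ?_⟩
  apply le_csInf
  · obtain ⟨P, hP⟩ := exists_proto f ε hε
    exact ⟨_, P, hP, rfl⟩
  · rintro _ ⟨P, hP, rfl⟩
    exact h P hP
end
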